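/- arXiv:1909.06668 — 2 statements merged into one kernel-verified Lean document; each statement's English description precedes it below -/
import Mathlib

section
/- Let G be a finite group such that H* := Hom(H,A) is finite for all H ≤ G, and let 𝕂 be a field of characteristic zero which is a splitting field for all H*, H ≤ G. Let 𝒳(G) be the set of pairs (H,Φ) with H ≤ G and Φ ∈ Hom(H*, 𝕂ˣ), with G acting by conjugation. Then the map B^A_𝕂(G) → (∏_{(H,Φ)∈𝒳(G)} 𝕂)^G, x ↦ (s_Φ(π_H(res^G_H(x))))_{(H,Φ)}, is an isomorphism of 𝕂-algebras. In particular every 𝕂-algebra homomorphism B^A_𝕂(G) → 𝕂 equals s^G_{(H,Φ)} := s_Φ ∘ π_H ∘ res^G_H for some (H,Φ), and s^G_{(H,Φ)} = s^G_{(K,Ψ)} iff (H,Φ) and (K,Ψ) are G-conjugate. -/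
open scoped Classical

section FiberedBurnside

variable {A : Type*} [CommGroup A]

/-- Conjugation action on pairs `(U, φ)` with `U ≤ G` and `φ : U →* A`:
`ᵍ(U,φ) = (ᵍU, ᵍφ)`. -/
def pairConj {G : Type*} [Group G] (g : G) (p : Σ U : Subgroup G, (↥U →* A)) :
    Σ U : Subgroup G, (↥U →* A) :=
  ⟨p.1.map ((MulAut.conj g : G ≃* G) : G →* G),
    p.2.comp ((MulEquiv.subgroupMap (MulAut.conj g : G ≃* G) p.1).symm.toMonoidHom)⟩

/-- `R` is a set of representatives for the `(H,K)`-double cosets in `G`. -/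
def IsDCR {G : Type*} [Group G] (H K : Subgroup G) (R : Finset G) : Prop :=
  (∀ x : G, ∃ r ∈ R, ∃ h ∈ H, ∃ k ∈ K, x = h * r * k) ∧
    ∀ r ∈ R, ∀ r' ∈ R, (∃ h ∈ H, ∃ k ∈ K, r' = h * r * k) → r = r'

/-- The pair `(U ∩ ᵍV, φ|·(ᵍψ)|)` occurring in the product formula. -/
def mulPair {G : Type*} [Group G] (p q : Σ U : Subgroup G, (↥U →* A)) (g : G) :
    Σ U : Subgroup G, (↥U →* A) :=
  ⟨p.1 ⊓ (pairConj g q).1,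
    (p.2.comp (Subgroup.inclusion inf_le_left)) *
      ((pairConj g q).2.comp (Subgroup.inclusion inf_le_right))⟩

/-- Data exhibiting a `𝕂`-algebra `B` as the `A`-fibered Burnside algebra `B^A_𝕂(G)`:
the standard basis elements `b (U,φ) = [U,φ]_G` are conjugation invariant, span, are
linearly independent over pairwise non-conjugate pairs, `[G,1]_G = 1`, and multiply by the
double coset formula. -/
structure FiberedBurnsideData (A : Type*) [CommGroup A] (G : Type*) [Group G]
    (𝕂 : Type*) [Field 𝕂] (B : Type*) [Ring B] [Algebra 𝕂 B] where
  b : (Σ U : Subgroup G, (↥U →* A)) → B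
  b_conj : ∀ (g : G) (p), b (pairConj g p) = b p
  b_one : b ⟨⊤, 1⟩ = 1
  b_span : Submodule.span 𝕂 (Set.range b) = ⊤
  b_indep : ∀ s : Finset (Σ U : Subgroup G, (↥U →* A)),
      (∀ p ∈ s, ∀ q ∈ s, (∃ g : G, pairConj g p = q) → p = q) →
      LinearIndependent 𝕂 (fun p : {x // x ∈ s} => b p.1)
  b_mul : ∀ (p q) (R : Finset G), IsDCR p.1 q.1 R →
      b p * b q = ∑ r ∈ R, b (mulPair p q r)

end FiberedBurnside

/-- Conjugation action on pairs `(H, Φ)` with `H ≤ G` and `Φ` a `C`-valued character of the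
character group `Hom(H,A)`:  `ᵍ(H,Φ) = (ᵍH, ᵍΦ)` where `ᵍΦ(φ') = Φ(ᵍ⁻¹φ')`. -/
def charPairConj {G : Type*} [Group G] {A : Type*} [CommGroup A] {C : Type*} [CommGroup C]
    (g : G) (x : Σ H : Subgroup G, ((↥H →* A) →* C)) :
    Σ H : Subgroup G, ((↥H →* A) →* C) :=
  ⟨x.1.map ((MulAut.conj g : G ≃* G) : G →* G),
    x.2.comp
      { toFun := fun φ' =>
          φ'.comp ((MulEquiv.subgroupMap (MulAut.conj g : G ≃* G) x.1).toMonoidHom)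
        map_one' := MonoidHom.one_comp _
        map_mul' := fun _ _ => MonoidHom.mul_comp _ _ _ }⟩

section Helpers

variable {A G : Type*} [CommGroup A] [Group G]

lemma pair_ext {p q : Σ U : Subgroup G, (↥U →* A)} (h : p.1 = q.1)
    (h2 : ∀ x (hx : x ∈ p.1) (hx' : x ∈ q.1), p.2 ⟨x, hx⟩ = q.2 ⟨x, hx'⟩) : p = q := by
  obtain ⟨U, φ⟩ := p
  obtain ⟨V, ψ⟩ := q
  obtain rfl : U = V := h
  congr 1
  ext ⟨x, hx⟩
  exact h2 x hx hx

lemma mem_pairConj (g : G) (p : Σ U : Subgroup G, (↥U →* A)) (x : G) :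
    x ∈ (pairConj g p).1 ↔ g⁻¹ * x * g ∈ p.1 := by
  simp only [pairConj, Subgroup.mem_map]
  constructor
  · rintro ⟨y, hy, rfl⟩
    simpa [mul_assoc] using hy
  · intro h
    exact ⟨_, h, by simp [mul_assoc]⟩

lemma pairConj_apply (g : G) (p : Σ U : Subgroup G, (↥U →* A)) (x : G)
    (hx : x ∈ (pairConj g p).1) :
    (pairConj g p).2 ⟨x, hx⟩ = p.2 ⟨g⁻¹ * x * g, (mem_pairConj g p x).1 hx⟩ := by
  change p.2 ((MulEquiv.subgroupMap (MulAut.conj g : G ≃* G) p.1).symm ⟨x, hx⟩) = _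
  congr 1

lemma pair_apply_congr (p : Σ U : Subgroup G, (↥U →* A)) {x y : G} (h : x = y)
    (hx : x ∈ p.1) (hy : y ∈ p.1) : p.2 ⟨x, hx⟩ = p.2 ⟨y, hy⟩ := by
  subst h; rfl

lemma pairConj_one (p : Σ U : Subgroup G, (↥U →* A)) : pairConj 1 p = p := by
  refine pair_ext ?_ ?_
  · ext x; simp [mem_pairConj]
  · intro x hx hx'
    rw [pairConj_apply]
    exact pair_apply_congr _ (by simp) _ _

lemma pairConj_mul (g h : G) (p : Σ U : Subgroup G, (↥U →* A)) :
    pairConj (g * h) p = pairConj g (pairConj h p) := by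
  refine pair_ext ?_ ?_
  · ext x; simp [mem_pairConj, mul_assoc]
  · intro x hx hx'
    rw [pairConj_apply, pairConj_apply, pairConj_apply]
    exact pair_apply_congr _ (by simp [mul_assoc]) _ _

lemma pairConj_self (p : Σ U : Subgroup G, (↥U →* A)) {u : G} (hu : u ∈ p.1) :
    pairConj u p = p := by
  refine pair_ext ?_ ?_
  · ext x
    rw [mem_pairConj, Subgroup.mul_mem_cancel_right _ hu,
      Subgroup.mul_mem_cancel_left _ (p.1.inv_mem hu)]
  · intro x hx hx'
    rw [pairConj_apply]
    have : (⟨u⁻¹ * x * u, (mem_pairConj u p x).1 hx⟩ : p.1)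
        = (⟨u, hu⟩ : p.1)⁻¹ * ⟨x, hx'⟩ * ⟨u, hu⟩ := by ext; simp
    rw [this, map_mul, map_mul, map_inv]
    simp [mul_comm]

variable {C : Type*} [CommGroup C]

lemma cpair_ext {p q : Σ H : Subgroup G, ((↥H →* A) →* C)} (h : p.1 = q.1)
    (h2 : ∀ (φ : p.1 →* A) (ψ : q.1 →* A),
      (∀ x (hx : x ∈ p.1) (hx' : x ∈ q.1), φ ⟨x, hx⟩ = ψ ⟨x, hx'⟩) → p.2 φ = q.2 ψ) : p = q := by
  obtain ⟨U, φ⟩ := p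
  obtain ⟨V, ψ⟩ := q
  obtain rfl : U = V := h
  congr 1
  ext a
  exact h2 a a (fun _ _ _ => rfl)

lemma mem_charPairConj (g : G) (p : Σ H : Subgroup G, ((↥H →* A) →* C)) (x : G) :
    x ∈ (charPairConj g p).1 ↔ g⁻¹ * x * g ∈ p.1 := by
  simp only [charPairConj, Subgroup.mem_map]
  constructor
  · rintro ⟨y, hy, rfl⟩
    simpa [mul_assoc] using hy
  · intro h
    exact ⟨_, h, by simp [mul_assoc]⟩

/-- Values of a conjugated character pair. -/
lemma charPairConj_apply (g : G) (p : Σ H : Subgroup G, ((↥H →* A) →* C))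
    (φ : (charPairConj g p).1 →* A) (ψ : p.1 →* A)
    (h : ∀ x (hx : x ∈ p.1) (hx' : g * x * g⁻¹ ∈ (charPairConj g p).1),
      φ ⟨g * x * g⁻¹, hx'⟩ = ψ ⟨x, hx⟩) :
    (charPairConj g p).2 φ = p.2 ψ := by
  change p.2 (φ.comp ((MulEquiv.subgroupMap (MulAut.conj g : G ≃* G) p.1).toMonoidHom)) = _
  congr 1
  ext ⟨x, hx⟩
  exact h x hx _

/-- Transport of a character along conjugation. -/
def backHom (g : G) (p : Σ H : Subgroup G, ((↥H →* A) →* C))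
    (φ : (charPairConj g p).1 →* A) : p.1 →* A :=
  φ.comp ((MulEquiv.subgroupMap (MulAut.conj g : G ≃* G) p.1).toMonoidHom)

lemma charPairConj_back (g : G) (p : Σ H : Subgroup G, ((↥H →* A) →* C))
    (φ : (charPairConj g p).1 →* A) : (charPairConj g p).2 φ = p.2 (backHom g p φ) := rfl

lemma backHom_apply (g : G) (p : Σ H : Subgroup G, ((↥H →* A) →* C))
    (φ : (charPairConj g p).1 →* A) (x : G) (hx : x ∈ p.1) :
    backHom g p φ ⟨x, hx⟩ = φ ⟨g * x * g⁻¹, (mem_charPairConj g p _).2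
      (by simpa [mul_assoc] using hx)⟩ := rfl

lemma charPairConj_one (p : Σ H : Subgroup G, ((↥H →* A) →* C)) : charPairConj 1 p = p := by
  refine cpair_ext ?_ ?_
  · ext x; simp [mem_charPairConj]
  · intro φ ψ h
    apply charPairConj_apply
    intro x hx hx'
    rw [← h x (by rw [mem_charPairConj]; simpa using hx)]
    congr 2; simp

lemma charPairConj_mul (g h : G) (p : Σ H : Subgroup G, ((↥H →* A) →* C)) :
    charPairConj (g * h) p = charPairConj g (charPairConj h p) := by
  refine cpair_ext ?_ ?_
  · ext x; simp [mem_charPairConj, mul_assoc]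
  · intro φ ψ hh
    rw [charPairConj_back g, charPairConj_back h]
    apply charPairConj_apply
    intro x hx hx'
    rw [backHom_apply, backHom_apply]
    rw [hh _ _ (by rw [mem_charPairConj, mem_charPairConj]; simpa [mul_assoc] using hx)]
    congr 2; simp [mul_assoc]

lemma charPairConj_self (p : Σ H : Subgroup G, ((↥H →* A) →* C)) {u : G} (hu : u ∈ p.1) :
    charPairConj u p = p := by
  refine cpair_ext ?_ ?_
  · ext x
    rw [mem_charPairConj, Subgroup.mul_mem_cancel_right _ hu,
      Subgroup.mul_mem_cancel_left _ (p.1.inv_mem hu)]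
  · intro φ ψ h
    apply charPairConj_apply
    intro x hx hx'
    have h1 : u * x * u⁻¹ ∈ p.1 := p.1.mul_mem (p.1.mul_mem hu hx) (p.1.inv_mem hu)
    rw [h _ _ h1]
    have : (⟨u * x * u⁻¹, h1⟩ : p.1)
        = (⟨u, hu⟩ : p.1) * ⟨x, hx⟩ * (⟨u, hu⟩)⁻¹ := by ext; simp
    rw [this, map_mul, map_mul, map_inv]
    simp [mul_comm]

variable {𝕂 : Type*} [Field 𝕂]

/-- Evaluation of a pair at a character pair. -/
noncomputable def EE (x : Σ H : Subgroup G, ((↥H →* A) →* 𝕂ˣ)) (p : Σ U : Subgroup G, (↥U →* A)) : 𝕂 :=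
  if h : x.1 ≤ p.1 then ((x.2 (p.2.comp (Subgroup.inclusion h)) : 𝕂ˣ) : 𝕂) else 0

lemma charPairConj_le_iff (g : G) (x : Σ H : Subgroup G, ((↥H →* A) →* 𝕂ˣ))
    (p : Σ U : Subgroup G, (↥U →* A)) :
    (charPairConj g x).1 ≤ (pairConj g p).1 ↔ x.1 ≤ p.1 :=
  Subgroup.map_le_map_iff_of_injective (MulAut.conj g).injective

lemma EE_conj (g : G) (x : Σ H : Subgroup G, ((↥H →* A) →* 𝕂ˣ))
    (p : Σ U : Subgroup G, (↥U →* A)) :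
    EE (charPairConj g x) (pairConj g p) = EE x p := by
  unfold EE
  by_cases h : x.1 ≤ p.1
  · rw [dif_pos h, dif_pos ((charPairConj_le_iff g x p).2 h)]
    congr 1
    apply charPairConj_apply
    intro y hy hy'
    change (pairConj g p).2 ⟨g * y * g⁻¹, _⟩ = p.2 ⟨y, _⟩
    rw [pairConj_apply]
    exact pair_apply_congr _ (by simp [mul_assoc]) _ _
  · rw [dif_neg h, dif_neg (fun h' => h ((charPairConj_le_iff g x p).1 h'))]

lemma EE_conj' (g : G) (x : Σ H : Subgroup G, ((↥H →* A) →* 𝕂ˣ))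
    (p : Σ U : Subgroup G, (↥U →* A)) :
    EE x (pairConj g p) = EE (charPairConj g⁻¹ x) p := by
  rw [← EE_conj g (charPairConj g⁻¹ x), ← charPairConj_mul, mul_inv_cancel, charPairConj_one]

lemma EE_mulPair (x : Σ H : Subgroup G, ((↥H →* A) →* 𝕂ˣ))
    (p q : Σ U : Subgroup G, (↥U →* A)) (r : G) :
    EE x (mulPair p q r) = EE x p * EE x (pairConj r q) := by
  unfold EE
  by_cases h1 : x.1 ≤ p.1
  · by_cases h2 : x.1 ≤ (pairConj r q).1
    · have h3 : x.1 ≤ (mulPair p q r).1 := le_inf h1 h2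
      rw [dif_pos h1, dif_pos h2, dif_pos h3, ← Units.val_mul, ← map_mul]
      rfl
    · rw [dif_neg h2, dif_neg (fun h : x.1 ≤ (mulPair p q r).1 => h2 (le_trans h inf_le_right)), mul_zero]
  · rw [dif_neg h1, dif_neg (fun h : x.1 ≤ (mulPair p q r).1 => h1 (le_trans h inf_le_left)), zero_mul]

lemma EE_top_one (x : Σ H : Subgroup G, ((↥H →* A) →* 𝕂ˣ)) : EE x ⟨⊤, 1⟩ = 1 := by
  unfold EE
  rw [dif_pos le_top, MonoidHom.one_comp, map_one, Units.val_one]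

lemma exists_DCR [Fintype G] (H K : Subgroup G) : ∃ R : Finset G, IsDCR H K R := by
  haveI : Finite (DoubleCoset.Quotient (H : Set G) (K : Set G)) := Quotient.finite _
  letI := Fintype.ofFinite (DoubleCoset.Quotient (H : Set G) (K : Set G))
  refine ⟨Finset.univ.image (fun q : DoubleCoset.Quotient (H : Set G) (K : Set G) => Quotient.out q), ?_, ?_⟩
  · intro x
    refine ⟨_, Finset.mem_image_of_mem _ (Finset.mem_univ (DoubleCoset.mk H K x)), ?_⟩
    have := Quotient.exact' (Quotient.out_eq' (DoubleCoset.mk H K x))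
    obtain ⟨a, ha, b, hb, h⟩ := (DoubleCoset.rel_iff).1 this
    exact ⟨a, ha, b, hb, h⟩
  · intro r hr r' hr' ⟨h, hh, k, hk, e⟩
    simp only [Finset.mem_image, Finset.mem_univ, true_and] at hr hr'
    obtain ⟨q, rfl⟩ := hr
    obtain ⟨q', rfl⟩ := hr'
    have : (DoubleCoset.mk H K q.out) = DoubleCoset.mk H K q'.out :=
      (DoubleCoset.eq H K _ _).2 ⟨h, hh, k, hk, e⟩
    have e1 : DoubleCoset.mk H K q.out = q := Quotient.out_eq' q
    have e2 : DoubleCoset.mk H K q'.out = q' := Quotient.out_eq' q'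
    rw [e1, e2] at this
    rw [this]

lemma sum_DCR [Fintype G] [CharZero 𝕂] (H K : Subgroup G) (R : Finset G) (hR : IsDCR H K R)
    (f : G → 𝕂) (hf : ∀ h ∈ H, ∀ k ∈ K, ∀ x, f (h * x * k) = f x) :
    ∑ r ∈ R, (Nat.card H * Nat.card K : 𝕂) /
      Nat.card (H ⊓ K.map ((MulAut.conj r : G ≃* G) : G →* G) : Subgroup G) * f r = ∑ x, f x := by
  have key : ∀ x : G, ∀ r ∈ R, (∃ h ∈ H, ∃ k ∈ K, x = h * r * k) →
      (Finset.univ.filter (fun y : H × K => (y.1 : G) * r * y.2 = x)).card =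
      Nat.card (H ⊓ K.map ((MulAut.conj r : G ≃* G) : G →* G) : Subgroup G) := by
    rintro x r - ⟨h, hh, k, hk, rfl⟩
    rw [← Fintype.card_subtype, ← Nat.card_eq_fintype_card]
    have hm : ∀ w : (H ⊓ K.map ((MulAut.conj r : G ≃* G) : G →* G) : Subgroup G),
        r⁻¹ * (w : G)⁻¹ * r ∈ K := by
      rintro ⟨w, hw1, y, hy, rfl⟩
      simpa [mul_assoc] using hy
    refine (Nat.card_congr (Equiv.ofBijective (fun w => ⟨(⟨h * w, H.mul_mem hh w.2.1⟩,
      ⟨r⁻¹ * (w : G)⁻¹ * r * k, K.mul_mem (hm w) hk⟩), by simp [mul_assoc]⟩) ⟨?_, ?_⟩)).symm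
    · intro w w' e
      simp only [Subtype.mk.injEq, Prod.mk.injEq] at e
      exact Subtype.ext (mul_left_cancel e.1)
    · rintro ⟨⟨⟨a, ha⟩, ⟨b, hb⟩⟩, e⟩
      simp only at e
      have e2 : b = r⁻¹ * (a⁻¹ * (h * r * k)) := by rw [← e]; group
      have e3 : h⁻¹ * a = r * (k * b⁻¹) * r⁻¹ := by rw [e2]; group
      refine ⟨⟨h⁻¹ * a, H.mul_mem (H.inv_mem hh) ha, ⟨k * b⁻¹, K.mul_mem hk (K.inv_mem hb), by
        rw [e3]; rfl⟩⟩, ?_⟩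
      apply Subtype.ext
      apply Prod.ext
      · apply Subtype.ext; simp
      · apply Subtype.ext; simp only [e2]; group
  have h1 : ∀ r ∈ R, (Nat.card H * Nat.card K : 𝕂) /
      Nat.card (H ⊓ K.map ((MulAut.conj r : G ≃* G) : G →* G) : Subgroup G) * f r
      = ∑ x, if (∃ h ∈ H, ∃ k ∈ K, x = h * r * k) then f x else 0 := by
    intro r hr
    have hc : (Nat.card (H ⊓ K.map ((MulAut.conj r : G ≃* G) : G →* G) : Subgroup G) : 𝕂) ≠ 0 := by
      exact_mod_cast Nat.card_pos.ne'
    rw [div_mul_eq_mul_div, div_eq_iff hc, Finset.sum_mul]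
    have : (Nat.card H * Nat.card K : 𝕂) * f r = ∑ y : H × K, f (y.1 * r * y.2) := by
      rw [Finset.sum_congr rfl (fun y _ => hf y.1 y.1.2 y.2 y.2.2 r)]
      simp [Nat.card_eq_fintype_card]
    rw [this, ← Finset.sum_fiberwise (s := Finset.univ) (g := fun y : H × K => (y.1 : G) * r * y.2)]
    refine Finset.sum_congr rfl fun x _ => ?_
    rw [Finset.sum_congr rfl (g := fun _ => f x)
      (fun y hy => by rw [(Finset.mem_filter.1 hy).2]), Finset.sum_const, nsmul_eq_mul]
    split_ifs with h
    · rw [key x r hr h, mul_comm]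
    · rw [zero_mul, Finset.card_eq_zero.2, Nat.cast_zero, zero_mul]
      rw [Finset.filter_eq_empty_iff]
      intro y _ e
      exact h ⟨y.1, y.1.2, y.2, y.2.2, e.symm⟩
  rw [Finset.sum_congr rfl h1, Finset.sum_comm]
  refine Finset.sum_congr rfl fun x _ => ?_
  obtain ⟨r, hr, hx⟩ := hR.1 x
  rw [Finset.sum_eq_single r, if_pos hx]
  · intro r' hr' hne
    rw [if_neg]
    rintro ⟨h', hh', k', hk', e'⟩
    obtain ⟨h, hh, k, hk, e⟩ := hx
    apply hne
    refine hR.2 r' hr' r hr ⟨h⁻¹ * h', H.mul_mem (H.inv_mem hh) hh', k' * k⁻¹,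
      K.mul_mem hk' (K.inv_mem hk), ?_⟩
    have : h * r * k = h' * r' * k' := e ▸ e'
    calc r = h⁻¹ * (h * r * k) * k⁻¹ := by group
      _ = _ := by rw [this]; group
  · intro h; exact absurd hr h

/-- The species in terms of a sum over the whole group. -/
lemma sum_EE [Fintype G] [CharZero 𝕂] (x : Σ H : Subgroup G, ((↥H →* A) →* 𝕂ˣ))
    (p : Σ U : Subgroup G, (↥U →* A)) (R : Finset G) (hR : IsDCR x.1 p.1 R) :
    (Nat.card p.1 : 𝕂) * ∑ r ∈ R, EE x (pairConj r p) = ∑ g, EE x (pairConj g p) := by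
  rw [← sum_DCR x.1 p.1 R hR (fun g => EE x (pairConj g p)), Finset.mul_sum]
  · refine Finset.sum_congr rfl fun r _ => ?_
    by_cases h : x.1 ≤ (pairConj r p).1
    · have h' : x.1 ⊓ p.1.map ((MulAut.conj r : G ≃* G) : G →* G) = x.1 := inf_eq_left.2 h
      rw [h']
      have hc : (Nat.card x.1 : 𝕂) ≠ 0 := by exact_mod_cast Nat.card_pos.ne'
      rw [mul_div_cancel_left₀ _ hc]
    · have : EE x (pairConj r p) = 0 := dif_neg h
      simp [this]
  · intro h hh k hk g
    rw [pairConj_mul, pairConj_mul, pairConj_self p hk, EE_conj',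
      charPairConj_self x (x.1.inv_mem hh)]

lemma char_sep {M : Type*} [CommGroup M] [Finite M]
    (hsplit : ∃ ζ : 𝕂, IsPrimitiveRoot ζ (Monoid.exponent M)) :
    Nat.card (M →* 𝕂ˣ) = Nat.card M ∧
    ∀ a : M → 𝕂, (∀ Φ : M →* 𝕂ˣ, ∑ᶠ m, a m * (Φ m : 𝕂) = 0) → a = 0 := by
  haveI : NeZero (Monoid.exponent M) := ⟨Monoid.exponent_ne_zero_of_finite⟩
  haveI : HasEnoughRootsOfUnity 𝕂 (Monoid.exponent M) := ⟨hsplit, inferInstance⟩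
  refine ⟨CommGroup.card_monoidHom_of_hasEnoughRootsOfUnity M 𝕂, ?_⟩
  intro a ha
  haveI := Fintype.ofFinite M
  let ev : M → ((M →* 𝕂ˣ) →* 𝕂) := fun m => (Units.coeHom 𝕂).comp (MonoidHom.eval m)
  have hev : Function.Injective ev := by
    intro m m' e
    by_contra hne
    have hne' : m * m'⁻¹ ≠ 1 := fun h => hne (mul_inv_eq_one.1 h)
    obtain ⟨φ, hφ⟩ := CommGroup.exists_apply_ne_one_of_hasEnoughRootsOfUnity M 𝕂 hne'
    apply hφ
    have := DFunLike.congr_fun e φ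
    have h2 : φ m = φ m' := Units.ext this
    rw [map_mul, map_inv, h2, mul_inv_cancel]
  have li := (linearIndependent_monoidHom (M →* 𝕂ˣ) 𝕂).comp ev hev
  rw [Fintype.linearIndependent_iff] at li
  funext m
  refine li a ?_ m
  funext Φ
  have := ha Φ
  rw [finsum_eq_sum_of_fintype] at this
  simpa [ev] using this

/-- The coefficient map is injective. -/
lemma T_inj [Fintype G] [CharZero 𝕂]
    [Fintype (Σ U : Subgroup G, (↥U →* A))]
    (hfin : ∀ H : Subgroup G, Finite (↥H →* A))
    (hsplit : ∀ H : Subgroup G, ∃ ζ : 𝕂, IsPrimitiveRoot ζ (Monoid.exponent (↥H →* A)))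
    (d : (Σ U : Subgroup G, (↥U →* A)) → 𝕂)
    (hd : ∀ x : Σ H : Subgroup G, ((↥H →* A) →* 𝕂ˣ), ∑ p, d p * EE x p = 0) : d = 0 := by
  suffices h : ∀ U : Subgroup G, ∀ φ : U →* A, d ⟨U, φ⟩ = 0 from funext fun p => h p.1 p.2
  intro U
  induction U using WellFoundedGT.induction with
  | ind U ih =>
  haveI := hfin U
  haveI : ∀ H : Subgroup G, Fintype (H →* A) := fun H => Fintype.ofFinite (H →* A)
  have : (fun φ : U →* A => d ⟨U, φ⟩) = 0 := by
    apply (char_sep (hsplit U)).2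
    intro Φ
    rw [finsum_eq_sum_of_fintype, ← hd ⟨U, Φ⟩]
    symm
    have hsig : (∑ p, d p * EE ⟨U, Φ⟩ p) =
        ∑ V : Subgroup G, ∑ φ : V →* A, d ⟨V, φ⟩ * EE ⟨U, Φ⟩ ⟨V, φ⟩ := by
      rw [← Fintype.sum_sigma (fun p : (Σ U : Subgroup G, (↥U →* A)) => d p * EE ⟨U, Φ⟩ p)]
      congr!
    rw [hsig, Finset.sum_eq_single U]
    · refine Finset.sum_congr rfl fun φ _ => ?_
      congr 1
      exact dif_pos le_rfl
    · intro V _ hV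
      refine Finset.sum_eq_zero fun φ _ => ?_
      by_cases h : U ≤ V
      · rw [ih V (lt_of_le_of_ne h hV.symm), zero_mul]
      · have : EE ⟨U, Φ⟩ ⟨V, φ⟩ = 0 := dif_neg h
        rw [this, mul_zero]
    · intro h; exact absurd (Finset.mem_univ _) h
  exact fun φ => congrFun this φ

end Helpers

theorem stmt_13 {A G 𝕂 B : Type*} [CommGroup A] [Group G] [Fintype G] [Field 𝕂] [CharZero 𝕂]
    [Ring B] [Algebra 𝕂 B]
    (hfin : ∀ H : Subgroup G, Finite (↥H →* A))
    (hsplit : ∀ H : Subgroup G, ∃ ζ : 𝕂, IsPrimitiveRoot ζ (Monoid.exponent (↥H →* A)))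
    (ℬ : FiberedBurnsideData A G 𝕂 B)
    (s : ∀ H : Subgroup G, ((↥H →* A) →* 𝕂ˣ) → (B →ₗ[𝕂] 𝕂))
    (hs : ∀ (H : Subgroup G) (Φ : (↥H →* A) →* 𝕂ˣ) (p : Σ U : Subgroup G, (↥U →* A))
      (R : Finset G), IsDCR H p.1 R →
      s H Φ (ℬ.b p) = ∑ r ∈ R,
        (if h : H ≤ (pairConj r p).1 then
          ((Φ ((pairConj r p).2.comp (Subgroup.inclusion h)) : 𝕂ˣ) : 𝕂) else 0)) :
    -- the species are conjugation invariant
    (∀ (g : G) (x : Σ H : Subgroup G, ((↥H →* A) →* 𝕂ˣ)) (v : B),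
        s (charPairConj g x).1 (charPairConj g x).2 v = s x.1 x.2 v) ∧
    -- each species is a 𝕂-algebra homomorphism
    (∀ (H : Subgroup G) (Φ : (↥H →* A) →* 𝕂ˣ), s H Φ 1 = 1) ∧
    (∀ (H : Subgroup G) (Φ : (↥H →* A) →* 𝕂ˣ) (v w : B),
        s H Φ (v * w) = s H Φ v * s H Φ w) ∧
    -- the total species map is injective and hits every G-invariant tuple,
    -- i.e. it is an isomorphism onto the G-fixed points of the product
    Function.Injective
      (fun v : B => fun x : Σ H : Subgroup G, ((↥H →* A) →* 𝕂ˣ) => s x.1 x.2 v) ∧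
    (∀ c : (Σ H : Subgroup G, ((↥H →* A) →* 𝕂ˣ)) → 𝕂,
        (∀ (g : G) (x), c (charPairConj g x) = c x) → ∃ v : B, ∀ x, s x.1 x.2 v = c x) ∧
    -- every 𝕂-algebra homomorphism B → 𝕂 is a species
    (∀ f : B →ₐ[𝕂] 𝕂, ∃ x : Σ H : Subgroup G, ((↥H →* A) →* 𝕂ˣ), ∀ v : B, f v = s x.1 x.2 v) ∧
    -- two species coincide iff the pairs are G-conjugate
    (∀ x y : Σ H : Subgroup G, ((↥H →* A) →* 𝕂ˣ),
        (∀ v : B, s x.1 x.2 v = s y.1 y.2 v) ↔ ∃ g : G, charPairConj g x = y) := by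
  haveI hfP : Finite (Σ U : Subgroup G, (↥U →* A)) := inferInstance
  haveI hfX1 : ∀ H : Subgroup G, Finite ((↥H →* A) →* 𝕂ˣ) := fun H => by
    apply Nat.finite_of_card_ne_zero
    rw [(char_sep (hsplit H)).1]
    exact Nat.card_pos.ne'
  haveI hfX : Finite (Σ H : Subgroup G, ((↥H →* A) →* 𝕂ˣ)) := inferInstance
  letI := Fintype.ofFinite (Σ U : Subgroup G, (↥U →* A))
  letI := Fintype.ofFinite (Σ H : Subgroup G, ((↥H →* A) →* 𝕂ˣ))
  have hc0 : ∀ U : Subgroup G, (Nat.card U : 𝕂) ≠ 0 := fun U => by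
    exact_mod_cast Nat.card_pos.ne'
  have hG0 : (Fintype.card G : 𝕂) ≠ 0 := by exact_mod_cast Fintype.card_ne_zero
  have hS : ∀ (x : Σ H : Subgroup G, ((↥H →* A) →* 𝕂ˣ)) (p : Σ U : Subgroup G, (↥U →* A)),
      (Nat.card p.1 : 𝕂) * s x.1 x.2 (ℬ.b p) = ∑ g, EE x (pairConj g p) := by
    intro x p
    obtain ⟨R, hR⟩ := exists_DCR x.1 p.1
    rw [← sum_EE x p R hR, hs x.1 x.2 p R hR]
    rfl
  -- conjugation invariance
  have hinv : ∀ (g : G) (x : Σ H : Subgroup G, ((↥H →* A) →* 𝕂ˣ)),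
      s (charPairConj g x).1 (charPairConj g x).2 = s x.1 x.2 := by
    intro g x
    refine LinearMap.ext_on_range ℬ.b_span fun p => ?_
    apply mul_left_cancel₀ (hc0 p.1)
    rw [hS, hS]
    refine Fintype.sum_equiv (Equiv.mulLeft g⁻¹) _ _ fun k => ?_
    rw [Equiv.coe_mulLeft, pairConj_mul, EE_conj' g⁻¹, inv_inv]
  have hone : ∀ (H : Subgroup G) (Φ : (↥H →* A) →* 𝕂ˣ), s H Φ 1 = 1 := by
    intro H Φ
    have h := hS ⟨H, Φ⟩ ⟨⊤, 1⟩
    rw [Finset.sum_congr rfl (g := fun _ => (1 : 𝕂)) (fun g _ => by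
      rw [pairConj_self _ (Subgroup.mem_top g), EE_top_one])] at h
    rw [ℬ.b_one] at h
    apply mul_left_cancel₀ (hc0 ⊤)
    rw [h]
    simp [Nat.card_eq_fintype_card]
  have hmulb : ∀ (x : Σ H : Subgroup G, ((↥H →* A) →* 𝕂ˣ)) (p q : Σ U : Subgroup G, (↥U →* A)),
      s x.1 x.2 (ℬ.b p * ℬ.b q) = s x.1 x.2 (ℬ.b p) * s x.1 x.2 (ℬ.b q) := by
    intro x p q
    obtain ⟨R, hR⟩ := exists_DCR p.1 q.1
    apply mul_left_cancel₀ (mul_ne_zero (hc0 p.1) (hc0 q.1))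
    rw [mul_mul_mul_comm, hS, hS, ℬ.b_mul p q R hR, map_sum, Finset.mul_sum]
    have h1 : ∀ r ∈ R, (Nat.card p.1 * Nat.card q.1 : 𝕂) * s x.1 x.2 (ℬ.b (mulPair p q r))
        = (Nat.card p.1 * Nat.card q.1 : 𝕂) /
          Nat.card (p.1 ⊓ q.1.map ((MulAut.conj r : G ≃* G) : G →* G) : Subgroup G) *
          (∑ g, EE x (pairConj g p) * EE x (pairConj (g * r) q)) := by
      intro r _
      have h2 : (Nat.card (p.1 ⊓ q.1.map ((MulAut.conj r : G ≃* G) : G →* G) : Subgroup G) : 𝕂)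
          * s x.1 x.2 (ℬ.b (mulPair p q r)) = _ := hS x (mulPair p q r)
      have h3 : ∑ g, EE x (pairConj g (mulPair p q r)) =
          ∑ g, EE x (pairConj g p) * EE x (pairConj (g * r) q) := by
        refine Finset.sum_congr rfl fun g _ => ?_
        rw [EE_conj' g, EE_mulPair, ← EE_conj' g, ← EE_conj' g, pairConj_mul]
      rw [← h3, ← h2, div_mul_eq_mul_div, eq_div_iff (hc0 _)]
      ring
    rw [Finset.sum_congr rfl h1,
      sum_DCR p.1 q.1 R hR (fun y => ∑ g, EE x (pairConj g p) * EE x (pairConj (g * y) q)),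
      Finset.sum_comm, Finset.sum_mul]
    · refine Finset.sum_congr rfl fun g _ => ?_
      rw [← Finset.mul_sum]
      congr 1
      exact Fintype.sum_equiv (Equiv.mulLeft g) _ _ fun k => rfl
    · intro u hu v hv y
      refine Fintype.sum_equiv (Equiv.mulRight u) _ _ fun g => ?_
      rw [Equiv.coe_mulRight, pairConj_mul g u, pairConj_self p hu, ← mul_assoc, ← mul_assoc,
        pairConj_mul _ v, pairConj_self q hv]
  have hmul : ∀ (H : Subgroup G) (Φ : (↥H →* A) →* 𝕂ˣ) (v w : B),
      s H Φ (v * w) = s H Φ v * s H Φ w := by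
    intro H Φ
    have h1 : ∀ p w, s H Φ (ℬ.b p * w) = s H Φ (ℬ.b p) * s H Φ w := by
      intro p w
      have : (s H Φ).comp (LinearMap.mulLeft 𝕂 (ℬ.b p)) = (s H Φ (ℬ.b p)) • s H Φ :=
        LinearMap.ext_on_range ℬ.b_span fun q => hmulb ⟨H, Φ⟩ p q
      exact LinearMap.congr_fun this w
    intro v w
    have : (s H Φ).comp (LinearMap.mulRight 𝕂 w) = (s H Φ w) • s H Φ :=
      LinearMap.ext_on_range ℬ.b_span fun q => by
        simpa [mul_comm] using h1 q w
    have := LinearMap.congr_fun this v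
    simpa [mul_comm] using this
  -- reindexing by conjugation
  let pcE : G → Equiv.Perm (Σ U : Subgroup G, (↥U →* A)) := fun g =>
    ⟨pairConj g, pairConj g⁻¹, fun p => by rw [← pairConj_mul, inv_mul_cancel, pairConj_one],
      fun p => by rw [← pairConj_mul, mul_inv_cancel, pairConj_one]⟩
  have hcard : ∀ (g : G) (p : Σ U : Subgroup G, (↥U →* A)),
      Nat.card (pairConj g p).1 = Nat.card p.1 := fun g p =>
    (Nat.card_congr (MulEquiv.subgroupMap (MulAut.conj g : G ≃* G) p.1).toEquiv).symm
  have hT : ∀ d : (Σ U : Subgroup G, (↥U →* A)) → 𝕂, (∀ g p, d (pairConj g p) = d p) →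
      ∀ x : Σ H : Subgroup G, ((↥H →* A) →* 𝕂ˣ),
      s x.1 x.2 (∑ p, (d p * Nat.card p.1) • ℬ.b p) =
        Fintype.card G * ∑ p, d p * EE x p := by
    intro d hd x
    rw [map_sum]
    have h1 : ∀ p ∈ (Finset.univ : Finset (Σ U : Subgroup G, (↥U →* A))),
        s x.1 x.2 ((d p * Nat.card p.1) • ℬ.b p) =
        ∑ g, d p * EE x (pairConj g p) := by
      intro p _
      rw [map_smul, smul_eq_mul, mul_assoc, hS, Finset.mul_sum]
    rw [Finset.sum_congr rfl h1, Finset.sum_comm]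
    have h2 : ∀ g ∈ (Finset.univ : Finset G), ∑ p, d p * EE x (pairConj g p)
        = ∑ p, d p * EE x p := by
      intro g _
      refine Fintype.sum_equiv (pcE g) _ _ fun p => ?_
      change _ = d (pairConj g p) * EE x (pairConj g p)
      rw [hd]
    rw [Finset.sum_congr rfl h2]
    simp
  have hinj0 : ∀ v : B, (∀ x : Σ H : Subgroup G, ((↥H →* A) →* 𝕂ˣ), s x.1 x.2 v = 0) → v = 0 := by
    intro v hv
    have hvs : v ∈ Submodule.span 𝕂 (Set.range ℬ.b) := by rw [ℬ.b_span]; trivial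
    obtain ⟨a, ha⟩ := (Submodule.mem_span_range_iff_exists_fun 𝕂).1 hvs
    let d : (Σ U : Subgroup G, (↥U →* A)) → 𝕂 := fun p =>
      (∑ g, a (pairConj g p)) / Nat.card p.1
    have hd : ∀ g p, d (pairConj g p) = d p := by
      intro g p
      simp only [d]
      rw [hcard]
      congr 1
      refine Fintype.sum_equiv (Equiv.mulRight g) _ _ fun k => ?_
      rw [Equiv.coe_mulRight, pairConj_mul]
    have hsum : ∑ p, (d p * Nat.card p.1) • ℬ.b p = (Fintype.card G : 𝕂) • v := by
      have h1 : ∀ p ∈ (Finset.univ : Finset (Σ U : Subgroup G, (↥U →* A))),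
          (d p * Nat.card p.1) • ℬ.b p = ∑ g, a (pairConj g p) • ℬ.b p := by
        intro p _
        simp only [d]
        rw [div_mul_cancel₀ _ (hc0 _), Finset.sum_smul]
      rw [Finset.sum_congr rfl h1, Finset.sum_comm]
      have h2 : ∀ g ∈ (Finset.univ : Finset G), ∑ p, a (pairConj g p) • ℬ.b p = v := by
        intro g _
        rw [← ha]
        refine Fintype.sum_equiv (pcE g) _ _ fun p => ?_
        change _ = a (pairConj g p) • ℬ.b (pairConj g p)
        rw [ℬ.b_conj]
      rw [Finset.sum_congr rfl h2, Finset.sum_const, Finset.card_univ, Nat.cast_smul_eq_nsmul]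
    have hd0 : d = 0 := by
      apply T_inj hfin hsplit
      intro x
      have h := hT d hd x
      rw [hsum, map_smul, hv, smul_zero] at h
      exact (mul_eq_zero.1 h.symm).resolve_left hG0
    have : (Fintype.card G : 𝕂) • v = 0 := by
      rw [← hsum, hd0]; simp
    exact (smul_eq_zero.1 this).resolve_left hG0
  have hsurj : ∀ c : (Σ H : Subgroup G, ((↥H →* A) →* 𝕂ˣ)) → 𝕂,
        (∀ (g : G) (x), c (charPairConj g x) = c x) → ∃ v : B, ∀ x, s x.1 x.2 v = c x := by
    intro c hc
    let T : ((Σ U : Subgroup G, (↥U →* A)) → 𝕂) →ₗ[𝕂]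
        ((Σ H : Subgroup G, ((↥H →* A) →* 𝕂ˣ)) → 𝕂) :=
      { toFun := fun d x => ∑ p, d p * EE x p
        map_add' := fun d e => by
          funext x; simp [add_mul, Finset.sum_add_distrib]
        map_smul' := fun k d => by
          funext x; simp [Finset.mul_sum, mul_assoc] }
    have hTi : Function.Injective T := by
      rw [injective_iff_map_eq_zero]
      intro d hd
      exact T_inj hfin hsplit d (fun x => congrFun hd x)
    have hcardPX : Nat.card (Σ U : Subgroup G, (↥U →* A)) =
        Nat.card (Σ H : Subgroup G, ((↥H →* A) →* 𝕂ˣ)) :=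
      Nat.card_congr (Equiv.sigmaCongrRight fun H =>
        (Finite.equivFin _).trans ((finCongr (char_sep (hsplit H)).1.symm).trans (Finite.equivFin _).symm))
    have hTs : Function.Surjective T := by
      refine (LinearMap.injective_iff_surjective_of_finrank_eq_finrank ?_).1 hTi
      rw [Module.finrank_fintype_fun_eq_card, Module.finrank_fintype_fun_eq_card,
        ← Nat.card_eq_fintype_card, ← Nat.card_eq_fintype_card, hcardPX]
    obtain ⟨d, hd⟩ := hTs (fun x => c x / Fintype.card G)
    have hd' : ∀ x, ∑ p, d p * EE x p = c x / Fintype.card G := fun x => congrFun hd x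
    have hdinv : ∀ g p, d (pairConj g p) = d p := by
      intro g
      have : (fun p => d (pairConj g p)) = d := by
        apply hTi
        rw [hd]
        funext x
        change ∑ p, d (pairConj g p) * EE x p = _
        rw [← hc g, ← hd']
        refine Fintype.sum_equiv (pcE g) _ _ fun p => ?_
        change _ = d (pairConj g p) * EE (charPairConj g x) (pairConj g p)
        rw [EE_conj]
      exact fun p => congrFun this p
    refine ⟨_, fun x => (hT d hdinv x).trans ?_⟩
    rw [hd', mul_div_cancel₀ _ hG0]
  refine ⟨fun g x v => by rw [hinv], hone, hmul, ?_, hsurj, ?_, ?_⟩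
  · intro v w h
    rw [← sub_eq_zero]
    apply hinj0
    intro x
    rw [map_sub, sub_eq_zero]
    exact congrFun h x
  · intro f
    by_contra! hcon
    choose w hw using hcon
    let sa : ∀ x : Σ H : Subgroup G, ((↥H →* A) →* 𝕂ˣ), B →ₐ[𝕂] 𝕂 := fun x =>
      AlgHom.ofLinearMap (s x.1 x.2) (hone _ _) (hmul _ _)
    let L := (Finset.univ : Finset (Σ H : Subgroup G, ((↥H →* A) →* 𝕂ˣ))).toList
    let P : B := (L.map fun x => w x - algebraMap 𝕂 B (s x.1 x.2 (w x))).prod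
    have hP : P = 0 := by
      apply hinj0
      intro x
      change sa x P = 0
      simp only [P]
      rw [map_list_prod]
      apply List.prod_eq_zero
      rw [List.map_map, List.mem_map]
      refine ⟨x, by simp [L], ?_⟩
      simp only [Function.comp, map_sub, AlgHom.commutes]
      exact sub_self _
    have hfP0 : f P = 0 := by rw [hP, map_zero]
    simp only [P] at hfP0
    rw [map_list_prod, List.prod_eq_zero_iff, List.map_map, List.mem_map] at hfP0
    obtain ⟨x, -, hx⟩ := hfP0
    simp only [Function.comp, map_sub, AlgHom.commutes] at hx
    exact hw x (sub_eq_zero.1 hx)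
  · intro x y
    constructor
    · intro h
      obtain ⟨v, hv⟩ := hsurj (fun z => if ∃ g : G, charPairConj g x = z then 1 else 0) (by
        intro g z
        refine if_congr ⟨?_, ?_⟩ rfl rfl
        · rintro ⟨k, hk⟩
          exact ⟨g⁻¹ * k, by rw [charPairConj_mul, hk, ← charPairConj_mul, inv_mul_cancel,
            charPairConj_one]⟩
        · rintro ⟨k, hk⟩
          exact ⟨g * k, by rw [charPairConj_mul, hk]⟩)
      have h1 := h v
      rw [hv, hv, if_pos ⟨1, charPairConj_one x⟩] at h1
      by_contra hne
      rw [if_neg hne] at h1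
      exact one_ne_zero h1
    · rintro ⟨g, rfl⟩ v
      rw [hinv]
end

section
/- Let G be a finite group with Hom(S,A) finite for all subquotients S of G and 𝕂 a characteristic-zero splitting field for them. For a normal subgroup N ⊴ G and Φ ∈ Hom(G*, 𝕂ˣ), the deflation constant satisfies m^N_{(G,Φ)} = (|(G/N)*|/(|G|·|G*|)) ∑_{K ≤ G, KN = G, Φ|_{K^⊥} = 1} |K|·|K^⊥|·μ(K,G), and in particular m^N_{(G,Φ)} is a rational number independent of 𝕂. -/
open scoped Classical

/-- Pullback (e.g. inflation) of `A`-valued characters of the full group along a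
homomorphism `f : G → G'`, written for the full subgroups `⊤`. -/
def charPull {G G' : Type*} [Group G] [Group G'] (A : Type*) [CommGroup A] (f : G →* G') :
    (↥(⊤ : Subgroup G') →* A) →* (↥(⊤ : Subgroup G) →* A) where
  toFun χ := χ.comp ((f.comp (Subgroup.subtype ⊤)).codRestrict ⊤ fun _ => Subgroup.mem_top _)
  map_one' := MonoidHom.one_comp _
  map_mul' _ _ := MonoidHom.mul_comp _ _ _

namespace Stmt15

theorem sigma_ext {A G : Type*} [CommGroup A] [Group G] (p q : Σ U : Subgroup G, (↥U →* A))
    (h1 : p.1 = q.1)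
    (h2 : ∀ (x : G) (hx : x ∈ p.1) (hx' : x ∈ q.1), p.2 ⟨x, hx⟩ = q.2 ⟨x, hx'⟩) : p = q := by
  obtain ⟨U, φ⟩ := p
  obtain ⟨V, ψ⟩ := q
  dsimp only at h1 h2
  subst h1
  congr 1
  ext ⟨x, hx⟩
  exact h2 x hx hx

theorem mem_pairConj {A G : Type*} [CommGroup A] [Group G] (g : G)
    (p : Σ U : Subgroup G, (↥U →* A)) (x : G) :
    x ∈ (pairConj g p).1 ↔ g⁻¹ * x * g ∈ p.1 := by
  simp only [pairConj, Subgroup.mem_map]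
  constructor
  · rintro ⟨y, hy, rfl⟩
    simpa [mul_assoc] using hy
  · intro h
    exact ⟨_, h, by simp [mul_assoc]⟩

theorem pairConj_apply {A G : Type*} [CommGroup A] [Group G] (g : G)
    (p : Σ U : Subgroup G, (↥U →* A)) (x : G) (hx : x ∈ (pairConj g p).1)
    (hx' : g⁻¹ * x * g ∈ p.1) :
    (pairConj g p).2 ⟨x, hx⟩ = p.2 ⟨g⁻¹ * x * g, hx'⟩ := by
  change p.2 ((MulEquiv.subgroupMap (MulAut.conj g : G ≃* G) p.1).symm ⟨x, hx⟩) = _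
  congr 1

theorem pairConj_mul {A G : Type*} [CommGroup A] [Group G] (g h : G)
    (p : Σ U : Subgroup G, (↥U →* A)) :
    pairConj g (pairConj h p) = pairConj (g * h) p := by
  apply sigma_ext
  · ext x
    simp [mem_pairConj, mul_assoc]
  · intro x hx hx'
    have h1 := (mem_pairConj _ _ _).1 hx
    have h2 := (mem_pairConj _ _ _).1 hx'
    have h3 := (mem_pairConj _ _ _).1 h1
    rw [pairConj_apply _ _ _ _ h1, pairConj_apply _ _ _ _ h2, pairConj_apply _ _ _ _ h3]
    congr 2
    simp [mul_assoc]

theorem pairConj_mem {A G : Type*} [CommGroup A] [Group G]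
    (p : Σ U : Subgroup G, (↥U →* A)) (g : G) (hg : g ∈ p.1) :
    pairConj g p = p := by
  have key : ∀ x, g⁻¹ * x * g ∈ p.1 ↔ x ∈ p.1 := by
    intro x
    rw [Subgroup.mul_mem_cancel_right _ hg, Subgroup.mul_mem_cancel_left _ (inv_mem hg)]
  apply sigma_ext
  · ext x
    rw [mem_pairConj, key]
  · intro x hx hx'
    rw [pairConj_apply _ _ _ _ ((key x).2 hx')]
    have : (⟨g⁻¹ * x * g, (key x).2 hx'⟩ : p.1) = (⟨g, hg⟩ : p.1)⁻¹ * ⟨x, hx'⟩ * ⟨g, hg⟩ := by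
      ext; simp
    rw [this, map_mul, map_mul, map_inv]
    rw [mul_comm, ← mul_assoc, mul_inv_cancel, one_mul]

def pairEquiv {A G : Type*} [CommGroup A] [Group G] (g : G) :
    (Σ U : Subgroup G, (↥U →* A)) ≃ (Σ U : Subgroup G, (↥U →* A)) where
  toFun := pairConj g
  invFun := pairConj g⁻¹
  left_inv p := by
    rw [pairConj_mul]
    exact pairConj_mem p _ (by simp)
  right_inv p := by
    rw [pairConj_mul]
    exact pairConj_mem p _ (by simp)

noncomputable def FF {A G 𝕂 : Type*} [CommGroup A] [Group G] [Field 𝕂] (K : Subgroup G)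
    (Ψ : (↥K →* A) →* 𝕂ˣ) (p : Σ U : Subgroup G, (↥U →* A)) : 𝕂 :=
  if h : K ≤ p.1 then ((Ψ (p.2.comp (Subgroup.inclusion h)) : 𝕂ˣ) : 𝕂) else 0

theorem FF_congr {A G 𝕂 : Type*} [CommGroup A] [Group G] [Field 𝕂] (K : Subgroup G)
    (Ψ : (↥K →* A) →* 𝕂ˣ) (p q : Σ U : Subgroup G, (↥U →* A))
    (h1 : K ≤ p.1 ↔ K ≤ q.1)
    (h2 : ∀ x ∈ K, ∀ (hx : x ∈ p.1) (hx' : x ∈ q.1), p.2 ⟨x, hx⟩ = q.2 ⟨x, hx'⟩) :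
    FF K Ψ p = FF K Ψ q := by
  unfold FF
  by_cases h : K ≤ p.1
  · have h' := h1.1 h
    rw [dif_pos h, dif_pos h']
    congr 2
    ext ⟨x, hx⟩
    exact h2 x hx _ _
  · rw [dif_neg h, dif_neg (fun h' => h (h1.2 h'))]

theorem exists_dcr {G : Type*} [Group G] [Fintype G] (H K : Subgroup G) :
    ∃ R : Finset G, IsDCR H K R ∧ ∃ ρ : G → G, (∀ g, ρ g ∈ R) ∧
      ∀ g, ∃ h ∈ H, ∃ k ∈ K, g = h * ρ g * k := by
  let S := DoubleCoset.setoid (H : Set G) (K : Set G)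
  have key : ∀ x y : G, S x y ↔ ∃ h ∈ H, ∃ k ∈ K, y = h * x * k := by
    intro x y
    exact DoubleCoset.rel_iff
  let ρ : G → G := fun g => (Quotient.mk S g).out
  have hρ : ∀ g, S (ρ g) g := fun g => Quotient.mk_out (s := S) g
  refine ⟨Finset.univ.image ρ, ⟨?_, ?_⟩, ρ, by simp, fun g => (key _ _).1 (hρ g)⟩
  · intro x
    exact ⟨ρ x, by simp, (key _ _).1 (hρ x)⟩
  · intro r hr r' hr' h
    simp only [Finset.mem_image, Finset.mem_univ, true_and] at hr hr'
    obtain ⟨a, rfl⟩ := hr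
    obtain ⟨b, rfl⟩ := hr'
    have h1 := (key _ _).2 h
    have h2 : S a b := S.trans (S.trans (S.symm (hρ a)) h1) (hρ b)
    have : Quotient.mk S a = Quotient.mk S b := Quotient.sound h2
    simp only [ρ, this]

theorem FF_dc {A G 𝕂 : Type*} [CommGroup A] [Group G] [Field 𝕂] (K : Subgroup G)
    (Ψ : (↥K →* A) →* 𝕂ˣ) (p : Σ U : Subgroup G, (↥U →* A)) (h r k : G) (hh : h ∈ K)
    (hk : k ∈ p.1) : FF K Ψ (pairConj (h * r * k) p) = FF K Ψ (pairConj r p) := by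
  rw [← pairConj_mul (h * r) k, pairConj_mem p k hk, ← pairConj_mul]
  by_cases hK : K ≤ (pairConj r p).1
  · rw [pairConj_mem _ h (hK hh)]
  · unfold FF
    rw [dif_neg hK, dif_neg]
    intro h2
    apply hK
    intro x hx
    have : h * x * h⁻¹ ∈ K := mul_mem (mul_mem hh hx) (inv_mem hh)
    have := (mem_pairConj _ _ _).1 (h2 this)
    simpa [mul_assoc] using this

theorem species_sum {A G 𝕂 : Type*} [CommGroup A] [Group G] [Fintype G] [Field 𝕂] [CharZero 𝕂]
    (K : Subgroup G)
    (Ψ : (↥K →* A) →* 𝕂ˣ) (p : Σ U : Subgroup G, (↥U →* A)) :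
    ∃ R : Finset G, IsDCR K p.1 R ∧ ∑ r ∈ R, FF K Ψ (pairConj r p) =
      (Nat.card p.1 : 𝕂)⁻¹ * ∑ g : G, FF K Ψ (pairConj g p) := by
  obtain ⟨R, hR, ρ, hρR, hρ⟩ := exists_dcr K p.1
  refine ⟨R, hR, ?_⟩
  have hc : (Nat.card p.1 : 𝕂) ≠ 0 := by
    exact_mod_cast Nat.card_pos.ne'
  rw [eq_inv_mul_iff_mul_eq₀ hc, Finset.mul_sum,
    ← Finset.sum_fiberwise_of_maps_to (s := Finset.univ) (t := R) (g := ρ) (fun g _ => hρR g)]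
  apply Finset.sum_congr rfl
  intro r hr
  have h1 : ∀ g ∈ Finset.univ.filter (fun g => ρ g = r),
      FF K Ψ (pairConj g p) = FF K Ψ (pairConj r p) := by
    intro g hg
    simp only [Finset.mem_filter, Finset.mem_univ, true_and] at hg
    obtain ⟨h, hh, k, hk, e⟩ := hρ g
    rw [hg] at e
    rw [e, FF_dc K Ψ p h r k hh hk]
  rw [Finset.sum_congr rfl h1, Finset.sum_const, nsmul_eq_mul]
  by_cases hK : K ≤ (pairConj r p).1
  · congr 2
    rw [← Nat.card_eq_finsetCard]
    refine Nat.card_congr ?_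
    refine Equiv.ofBijective (fun u : p.1 => ⟨r * u, ?_⟩) ⟨?_, ?_⟩
    · simp only [Finset.mem_filter, Finset.mem_univ, true_and]
      obtain ⟨h, hh, k, hk, e⟩ := hρ (r * u)
      refine hR.2 _ (hρR _) _ hr ⟨h, hh, k * (u : G)⁻¹, mul_mem hk (inv_mem u.2), ?_⟩
      rw [← mul_assoc, ← e]; simp
    · intro u v huv
      simpa using huv
    · rintro ⟨g, hg⟩
      simp only [Finset.mem_filter, Finset.mem_univ, true_and] at hg
      obtain ⟨h, hh, k, hk, e⟩ := hρ g
      rw [hg] at e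
      have := (mem_pairConj _ _ _).1 (hK hh)
      refine ⟨⟨_, mul_mem this hk⟩, ?_⟩
      simp only [Subtype.mk.injEq]
      rw [e]; simp [mul_assoc]
  · have : FF K Ψ (pairConj r p) = 0 := by
      unfold FF; rw [dif_neg hK]
    rw [this]; simp

theorem dual_zero {X 𝕂 : Type*} [CommGroup X] [Fintype X] [Field 𝕂] [CharZero 𝕂]
    (hs : ∃ ζ : 𝕂, IsPrimitiveRoot ζ (Monoid.exponent X)) (a : X → 𝕂)
    (ha : ∀ Ψ : X →* 𝕂ˣ, ∑ x, a x * (Ψ x : 𝕂) = 0) (x : X) : a x = 0 := by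
  haveI : NeZero (Monoid.exponent X) := ⟨Monoid.exponent_ne_zero_of_finite⟩
  haveI : HasEnoughRootsOfUnity 𝕂 (Monoid.exponent X) := ⟨hs, inferInstance⟩
  obtain ⟨e⟩ := CommGroup.monoidHom_mulEquiv_of_hasEnoughRootsOfUnity X 𝕂
  haveI : Finite (X →* 𝕂ˣ) := Finite.of_equiv _ e.toEquiv.symm
  letI : Fintype (X →* 𝕂ˣ) := Fintype.ofFinite _
  have h1 : ∀ y : X, ∑ Ψ : X →* 𝕂ˣ, ((Ψ y : 𝕂ˣ) : 𝕂) =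
      if y = 1 then (Fintype.card (X →* 𝕂ˣ) : 𝕂) else 0 := by
    intro y
    have := sum_hom_units ((Units.coeHom 𝕂).comp (MonoidHom.eval y : (X →* 𝕂ˣ) →* 𝕂ˣ))
    simp only [MonoidHom.comp_apply, MonoidHom.eval_apply_apply, Units.coeHom_apply] at this
    rw [this]
    by_cases hy : y = 1
    · rw [if_pos hy, if_pos]
      · ext Ψ; simp [hy]
    · rw [if_neg hy, if_neg]
      · simp
      · intro h
        obtain ⟨Ψ, hΨ⟩ := CommGroup.exists_apply_ne_one_of_hasEnoughRootsOfUnity X 𝕂 hy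
        apply hΨ
        have := DFunLike.congr_fun h Ψ
        ext
        simpa using this
  have h2 : ∑ Ψ : X →* 𝕂ˣ, ((Ψ x⁻¹ : 𝕂ˣ) : 𝕂) * ∑ y, a y * (Ψ y : 𝕂) = 0 := by
    simp [ha]
  have h3 : ∑ Ψ : X →* 𝕂ˣ, ((Ψ x⁻¹ : 𝕂ˣ) : 𝕂) * ∑ y, a y * (Ψ y : 𝕂) =
      ∑ y, a y * ∑ Ψ : X →* 𝕂ˣ, ((Ψ (y * x⁻¹) : 𝕂ˣ) : 𝕂) := by
    simp only [Finset.mul_sum]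
    rw [Finset.sum_comm]
    refine Finset.sum_congr rfl fun y _ => Finset.sum_congr rfl fun Ψ _ => ?_
    rw [map_mul Ψ y, Units.val_mul]; ring
  rw [h3] at h2
  simp only [h1, mul_inv_eq_one] at h2
  simp at h2
  exact h2

theorem species_inj {A G 𝕂 B : Type*} [CommGroup A] [Group G] [Fintype G] [Field 𝕂] [CharZero 𝕂]
    [Ring B] [Algebra 𝕂 B]
    (hfin : ∀ K : Subgroup G, Finite (↥K →* A))
    (hsplit : ∀ K : Subgroup G, ∃ ζ : 𝕂, IsPrimitiveRoot ζ (Monoid.exponent (↥K →* A)))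
    (D : FiberedBurnsideData A G 𝕂 B)
    (s : ∀ K : Subgroup G, ((↥K →* A) →* 𝕂ˣ) → (B →ₗ[𝕂] 𝕂))
    (hs : ∀ K Ψ p, s K Ψ (D.b p) =
      (Nat.card p.1 : 𝕂)⁻¹ * ∑ g : G, FF K Ψ (pairConj g p))
    (x : B) (hx : ∀ K Ψ, s K Ψ x = 0) : x = 0 := by
  haveI : Finite (Subgroup G) := inferInstance
  letI : Fintype (Σ U : Subgroup G, (↥U →* A)) := Fintype.ofFinite _
  have hxs : x ∈ Submodule.span 𝕂 (Set.range D.b) := by rw [D.b_span]; trivial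
  obtain ⟨c, hc⟩ := (Submodule.mem_span_range_iff_exists_fun 𝕂).1 hxs
  let c' : (Σ U : Subgroup G, (↥U →* A)) → 𝕂 := fun p => ∑ g : G, c (pairConj g p)
  have hG : (Fintype.card G : 𝕂) ≠ 0 := by exact_mod_cast Fintype.card_ne_zero
  have hc'x : ∑ p, c' p • D.b p = (Fintype.card G : 𝕂) • x := by
    simp only [c', Finset.sum_smul]
    rw [Finset.sum_comm]
    have : ∀ g : G, ∑ p, c (pairConj g p) • D.b p = x := by
      intro g
      rw [← hc, ← Equiv.sum_comp (pairEquiv g) (fun p => c p • D.b p)]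
      refine Finset.sum_congr rfl fun p _ => ?_
      change _ = c (pairConj g p) • D.b (pairConj g p)
      rw [D.b_conj]
    simp [this, Nat.cast_smul_eq_nsmul]
  have hinv : ∀ g p, c' (pairConj g p) = c' p := by
    intro g p
    simp only [c', pairConj_mul]
    exact Equiv.sum_comp (Equiv.mulRight g) (fun h => c (pairConj h p))
  have hcard : ∀ (g : G) (p : Σ U : Subgroup G, (↥U →* A)),
      Nat.card (pairConj g p).1 = Nat.card p.1 := by
    intro g p
    exact Nat.card_congr (MulEquiv.subgroupMap (MulAut.conj g : G ≃* G) p.1).symm.toEquiv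
  have hsum : ∀ (K : Subgroup G) (Ψ : (↥K →* A) →* 𝕂ˣ),
      ∑ p, (c' p * (Nat.card p.1 : 𝕂)⁻¹) * FF K Ψ p = 0 := by
    intro K Ψ
    have h1 : s K Ψ (∑ p, c' p • D.b p) = 0 := by rw [hc'x, map_smul, hx, smul_zero]
    simp only [map_sum, map_smul, hs, smul_eq_mul, Finset.mul_sum] at h1
    rw [Finset.sum_comm] at h1
    have : ∀ g : G, ∑ p, c' p * ((Nat.card p.1 : 𝕂)⁻¹ * FF K Ψ (pairConj g p)) =
        ∑ p, (c' p * (Nat.card p.1 : 𝕂)⁻¹) * FF K Ψ p := by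
      intro g
      rw [← Equiv.sum_comp (pairEquiv g)
        (fun p => (c' p * (Nat.card p.1 : 𝕂)⁻¹) * FF K Ψ p)]
      refine Finset.sum_congr rfl fun p _ => ?_
      change _ = (c' (pairConj g p) * (Nat.card (pairConj g p).1 : 𝕂)⁻¹) * FF K Ψ (pairConj g p)
      rw [hinv, hcard, mul_assoc]
    simp only [this, Finset.sum_const, nsmul_eq_mul, Finset.card_univ] at h1
    exact (mul_eq_zero.1 h1).resolve_left hG
  have hzero : ∀ (U : Subgroup G) (φ : ↥U →* A), c' ⟨U, φ⟩ = 0 := by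
    intro U
    induction U using WellFoundedGT.induction with
    | ind U ih =>
      intro φ
      letI : Fintype (↥U →* A) := Fintype.ofFinite _
      have h0 := dual_zero (hsplit U) (fun φ => c' ⟨U, φ⟩ * (Nat.card U : 𝕂)⁻¹) (by
        intro Ψ
        rw [← hsum U Ψ]
        refine Fintype.sum_of_injective (fun φ : ↥U →* A =>
          (⟨U, φ⟩ : Σ U : Subgroup G, (↥U →* A))) ?_ _ _ ?_ ?_
        · intro φ ψ h
          simpa using h
        · rintro ⟨V, ψ⟩ hp
          by_cases hUV : U ≤ V
          · rcases hUV.eq_or_lt with h | h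
            · subst h
              exact absurd ⟨ψ, rfl⟩ hp
            · rw [ih V h]; simp
          · unfold FF
            rw [dif_neg hUV]; simp
        · intro φ
          unfold FF
          rw [dif_pos le_rfl]
          rfl) φ
      have hU : (Nat.card U : 𝕂) ≠ 0 := by exact_mod_cast Nat.card_pos.ne'
      simpa [hU] using h0
  have : ∑ p, c' p • D.b p = 0 :=
    Finset.sum_eq_zero fun p _ => by rw [hzero p.1 p.2, zero_smul]
  rw [hc'x] at this
  exact (smul_eq_zero.1 this).resolve_left hG

/-- Weisner's theorem, in the form needed here. -/
theorem weisner {G 𝕂 : Type*} [Group G] [Fintype (Subgroup G)] [Field 𝕂]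
    (ν : Subgroup G → ℤ)
    (hν : ∀ M, (∑ K : Subgroup G, if M ≤ K then ν K else 0) = if M = ⊤ then 1 else 0)
    (L : Subgroup G) (hL : L ≠ ⊤) (W : Subgroup G → 𝕂) (hW : ∀ K, W K = W (K ⊓ L)) :
    ∑ K, (ν K : 𝕂) * W K = 0 := by
  have hT : ∀ M : Subgroup G, ∑ K ∈ Finset.univ.filter (fun K => K ⊓ L = M), ν K = 0 := by
    intro M
    induction M using WellFoundedGT.induction with
    | ind M ih =>
      by_cases hM : M ≤ L
      · have h1 := hν M
        rw [if_neg (fun h : M = ⊤ => hL (top_le_iff.1 (h ▸ hM))), ← Finset.sum_filter,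
          ← Finset.sum_fiberwise_of_maps_to (s := Finset.univ.filter (fun K => M ≤ K))
            (t := Finset.univ.filter (fun K => M ≤ K)) (g := fun K => K ⊓ L) (by
              intro K hK
              simp only [Finset.mem_filter, Finset.mem_univ, true_and] at hK ⊢
              exact le_inf hK hM), Finset.sum_eq_single M] at h1
        · rw [← h1, Finset.filter_filter]
          refine Finset.sum_congr ?_ fun _ _ => rfl
          ext K
          simp only [Finset.mem_filter, Finset.mem_univ, true_and]
          constructor
          · intro h; exact ⟨h ▸ inf_le_left, h⟩
          · exact fun h => h.2
        · intro M' hM' hne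
          simp only [Finset.mem_filter, Finset.mem_univ, true_and] at hM'
          rw [← ih M' (lt_of_le_of_ne hM' hne.symm), Finset.filter_filter]
          refine Finset.sum_congr ?_ fun _ _ => rfl
          ext K
          simp only [Finset.mem_filter, Finset.mem_univ, true_and]
          constructor
          · exact fun h => h.2
          · intro h; exact ⟨hM'.trans (h ▸ inf_le_left), h⟩
        · intro h
          simp at h
      · apply Finset.sum_eq_zero
        intro K hK
        simp only [Finset.mem_filter, Finset.mem_univ, true_and] at hK
        exact absurd (hK ▸ inf_le_right) hM
  rw [← Finset.sum_fiberwise (s := Finset.univ) (g := fun K => K ⊓ L)]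
  apply Finset.sum_eq_zero
  intro M _
  have : ∀ K ∈ Finset.univ.filter (fun K => K ⊓ L = M), (ν K : 𝕂) * W K = (ν K : 𝕂) * W M := by
    intro K hK
    simp only [Finset.mem_filter, Finset.mem_univ, true_and] at hK
    rw [hW, hK]
  rw [Finset.sum_congr rfl this, ← Finset.sum_mul, ← Int.cast_sum, hT]
  simp

def pr {A G : Type*} [CommGroup A] [Group G] (φ : ↥(⊤ : Subgroup G) →* A) (K : Subgroup G) :
    Σ U : Subgroup G, (↥U →* A) := ⟨K, φ.comp (Subgroup.inclusion le_top)⟩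

theorem pr_apply {A G : Type*} [CommGroup A] [Group G] (φ : ↥(⊤ : Subgroup G) →* A)
    (K : Subgroup G) (x : G) (hx : x ∈ (pr φ K).1) : (pr φ K).2 ⟨x, hx⟩ = φ ⟨x, trivial⟩ := rfl

theorem pairConj_pr {A G : Type*} [CommGroup A] [Group G] (φ : ↥(⊤ : Subgroup G) →* A)
    (K : Subgroup G) (g : G) :
    pairConj g (pr φ K) = pr φ ((MulAut.conj g).mapSubgroup K) := by
  apply sigma_ext
  · rfl
  · intro x hx hx'
    rw [pairConj_apply _ _ _ _ ((mem_pairConj _ _ _).1 hx), pr_apply, pr_apply]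
    have : (⟨g⁻¹ * x * g, trivial⟩ : (⊤ : Subgroup G)) =
      (⟨g, trivial⟩ : (⊤ : Subgroup G))⁻¹ * ⟨x, trivial⟩ * ⟨g, trivial⟩ := rfl
    rw [this, map_mul, map_mul, map_inv]
    rw [mul_comm, ← mul_assoc, mul_inv_cancel, one_mul]

theorem FF_pr {A G 𝕂 : Type*} [CommGroup A] [Group G] [Field 𝕂] (H : Subgroup G)
    (Ψ : (↥H →* A) →* 𝕂ˣ) (φ : ↥(⊤ : Subgroup G) →* A) (K : Subgroup G) :
    FF H Ψ (pr φ K) = if H ≤ K then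
      ((Ψ (φ.comp (Subgroup.inclusion le_top)) : 𝕂ˣ) : 𝕂) else 0 := by
  unfold FF
  by_cases h : H ≤ K
  · rw [dif_pos (show H ≤ (pr φ K).1 from h), if_pos h]
    rfl
  · rw [dif_neg (show ¬ H ≤ (pr φ K).1 from h), if_neg h]

theorem moebius_iso {G : Type*} [Group G] [Fintype (Subgroup G)]
    (ν : Subgroup G → ℤ)
    (hν : ∀ M, (∑ K : Subgroup G, if M ≤ K then ν K else 0) = if M = ⊤ then 1 else 0)
    (e : Subgroup G ≃o Subgroup G) (M : Subgroup G) :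
    (∑ K : Subgroup G, if M ≤ e K then ν K else 0) = if M = ⊤ then 1 else 0 := by
  have h := hν (e.symm M)
  simp only [e.symm_apply_le] at h
  rw [h]
  have : e.symm M = ⊤ ↔ M = ⊤ := by
    rw [e.symm_apply_eq, map_top]
  simp only [this]

theorem charPairConj_top {A G C : Type*} [CommGroup A] [Group G] [CommGroup C] (g : G)
    (Φ : (↥(⊤ : Subgroup G) →* A) →* C) :
    charPairConj g (⟨⊤, Φ⟩ : Σ K : Subgroup G, ((↥K →* A) →* C)) = ⟨⊤, Φ⟩ := by
  have key : ∀ (U : Subgroup G) (hU : U = ⊤)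
      (Ψ : (↥U →* A) →* C), (∀ φ : ↥(⊤ : Subgroup G) →* A,
        Ψ (φ.comp (Subgroup.inclusion le_top)) = Φ φ) →
      (⟨U, Ψ⟩ : Σ K : Subgroup G, ((↥K →* A) →* C)) = ⟨⊤, Φ⟩ := by
    intro U hU Ψ h
    subst hU
    congr 1
    ext φ
    rw [← h φ]
    rfl
  apply key
  · exact map_top (MulAut.conj g).mapSubgroup
  · intro φ
    change Φ _ = Φ φ
    congr 1
    ext x
    change φ (⟨g * x.1 * g⁻¹, trivial⟩) = φ x
    have : (⟨g * x.1 * g⁻¹, trivial⟩ : (⊤ : Subgroup G)) =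
      (⟨g, trivial⟩ : (⊤ : Subgroup G)) * x * (⟨g, trivial⟩ : (⊤ : Subgroup G))⁻¹ := rfl
    rw [this, map_mul, map_mul, map_inv]
    rw [mul_comm, ← mul_assoc, inv_mul_cancel, one_mul]

theorem charPairConj_iff {A G C : Type*} [CommGroup A] [Group G] [CommGroup C]
    (Φ Ψ : (↥(⊤ : Subgroup G) →* A) →* C) :
    (∃ g : G, charPairConj g (⟨⊤, Φ⟩ : Σ K : Subgroup G, ((↥K →* A) →* C)) = ⟨⊤, Ψ⟩) ↔
      Φ = Ψ := by
  simp only [charPairConj_top]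
  simp

theorem charPairConj_ne {A G C : Type*} [CommGroup A] [Group G] [CommGroup C]
    (Φ : (↥(⊤ : Subgroup G) →* A) →* C) (K : Subgroup G) (hK : K ≠ ⊤) (Ψ : (↥K →* A) →* C) :
    ¬ (∃ g : G, charPairConj g (⟨⊤, Φ⟩ : Σ K : Subgroup G, ((↥K →* A) →* C)) = ⟨K, Ψ⟩) := by
  simp only [charPairConj_top]
  rintro ⟨_, h⟩
  exact hK (congrArg Sigma.fst h).symm

theorem sum_char {X 𝕂 : Type*} [CommGroup X] [Fintype X] [Field 𝕂] (Φ Ψ : X →* 𝕂ˣ) :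
    ∑ x, ((Φ x⁻¹ : 𝕂ˣ) : 𝕂) * ((Ψ x : 𝕂ˣ) : 𝕂) = if Φ = Ψ then (Nat.card X : 𝕂) else 0 := by
  have := sum_hom_units ((Units.coeHom 𝕂).comp (Φ⁻¹ * Ψ))
  simp only [MonoidHom.comp_apply, MonoidHom.mul_apply, MonoidHom.inv_apply, Units.coeHom_apply,
    Units.val_mul] at this
  simp only [map_inv]
  rw [this, Nat.card_eq_fintype_card]
  by_cases h : Φ = Ψ
  · rw [if_pos h, if_pos]
    subst h
    ext x; simp
  · rw [if_neg h, if_neg]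
    · simp
    · intro h'
      apply h
      ext x
      have := DFunLike.congr_fun h' x
      simp only [MonoidHom.comp_apply, MonoidHom.mul_apply, MonoidHom.inv_apply,
        Units.coeHom_apply, MonoidHom.one_apply, Units.val_eq_one] at this
      rw [inv_mul_eq_one] at this
      rw [this]

noncomputable def expl {A G 𝕂 B : Type*} [CommGroup A] [Group G] [Field 𝕂]
    [Ring B] [Algebra 𝕂 B] [Fintype (Subgroup G)] [Fintype (↥(⊤ : Subgroup G) →* A)]
    (D : FiberedBurnsideData A G 𝕂 B) (ν : Subgroup G → ℤ)
    (Φ : (↥(⊤ : Subgroup G) →* A) →* 𝕂ˣ) : B :=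
  ((Nat.card G : 𝕂) * (Nat.card (↥(⊤ : Subgroup G) →* A) : 𝕂))⁻¹ •
    ∑ φ : ↥(⊤ : Subgroup G) →* A, ∑ K : Subgroup G,
      ((Nat.card K : 𝕂) * (ν K : 𝕂) * ((Φ φ⁻¹ : 𝕂ˣ) : 𝕂)) • D.b (pr φ K)

theorem expl_species {A G 𝕂 B : Type*} [CommGroup A] [Group G] [Fintype G] [Field 𝕂] [CharZero 𝕂]
    [Ring B] [Algebra 𝕂 B] [Fintype (Subgroup G)] [Fintype (↥(⊤ : Subgroup G) →* A)]
    (D : FiberedBurnsideData A G 𝕂 B)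
    (s : ∀ K : Subgroup G, ((↥K →* A) →* 𝕂ˣ) → (B →ₗ[𝕂] 𝕂))
    (hs : ∀ K Ψ p, s K Ψ (D.b p) =
      (Nat.card p.1 : 𝕂)⁻¹ * ∑ g : G, FF K Ψ (pairConj g p))
    (ν : Subgroup G → ℤ)
    (hν : ∀ M, (∑ K : Subgroup G, if M ≤ K then ν K else 0) = if M = ⊤ then 1 else 0)
    (Φ : (↥(⊤ : Subgroup G) →* A) →* 𝕂ˣ) (H : Subgroup G) (Ψ : (↥H →* A) →* 𝕂ˣ) :
    s H Ψ (expl D ν Φ) = if ∃ g : G, charPairConj g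
        (⟨⊤, Φ⟩ : Σ K : Subgroup G, ((↥K →* A) →* 𝕂ˣ)) = ⟨H, Ψ⟩ then 1 else 0 := by
  have hG : (Nat.card G : 𝕂) ≠ 0 := by exact_mod_cast Nat.card_pos.ne'
  have hGd : (Nat.card (↥(⊤ : Subgroup G) →* A) : 𝕂) ≠ 0 := by exact_mod_cast Nat.card_pos.ne'
  have h1 : ∀ φ : ↥(⊤ : Subgroup G) →* A,
      ∑ K : Subgroup G, ((Nat.card K : 𝕂) * (ν K : 𝕂) * ((Φ φ⁻¹ : 𝕂ˣ) : 𝕂)) *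
        s H Ψ (D.b (pr φ K)) = (if H = ⊤ then (Nat.card G : 𝕂) else 0) *
          (((Φ φ⁻¹ : 𝕂ˣ) : 𝕂) * ((Ψ (φ.comp (Subgroup.inclusion le_top)) : 𝕂ˣ) : 𝕂)) := by
    intro φ
    have h2 : ∀ K : Subgroup G, ((Nat.card K : 𝕂) * (ν K : 𝕂) * ((Φ φ⁻¹ : 𝕂ˣ) : 𝕂)) *
        s H Ψ (D.b (pr φ K)) = ∑ g : G, ((if H ≤ (MulAut.conj g).mapSubgroup K then
          ν K else 0 : ℤ) : 𝕂) *
          (((Φ φ⁻¹ : 𝕂ˣ) : 𝕂) * ((Ψ (φ.comp (Subgroup.inclusion le_top)) : 𝕂ˣ) : 𝕂)) := by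
      intro K
      have hK : (Nat.card K : 𝕂) ≠ 0 := by exact_mod_cast Nat.card_pos.ne'
      rw [hs]
      simp only [pairConj_pr, FF_pr]
      change _ * ((Nat.card K : 𝕂)⁻¹ * _) = _
      rw [Finset.mul_sum, Finset.mul_sum]
      refine Finset.sum_congr rfl fun g _ => ?_
      split_ifs
      · field_simp
      · simp
    rw [Finset.sum_congr rfl fun K _ => h2 K, Finset.sum_comm]
    simp only [← Finset.sum_mul, ← Int.cast_sum, moebius_iso ν hν]
    congr 1
    split_ifs <;> simp
  unfold expl
  simp only [map_smul, map_sum, smul_eq_mul]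
  rw [Finset.sum_congr rfl fun φ _ => h1 φ, ← Finset.mul_sum]
  by_cases hH : H = ⊤
  · subst hH
    rw [if_pos rfl]
    have := sum_char Φ Ψ
    simp only [charPairConj_iff]
    change _ * (_ * ∑ φ : ↥(⊤ : Subgroup G) →* A, ((Φ φ⁻¹ : 𝕂ˣ) : 𝕂) * ((Ψ φ : 𝕂ˣ) : 𝕂)) = _
    rw [this]
    split_ifs
    · field_simp
    · simp
  · rw [if_neg hH, if_neg (charPairConj_ne Φ H hH Ψ)]
    simp

def Triv {A G : Type*} [CommGroup A] [Group G] (N : Subgroup G)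
    (p : Σ U : Subgroup G, (↥U →* A)) : Prop := ∀ u : ↥p.1, (u : G) ∈ N → p.2 u = 1

def IsDefl {A G : Type*} [CommGroup A] [Group G] (N : Subgroup G) [N.Normal]
    (p : Σ U : Subgroup G, (↥U →* A)) (q : Σ V : Subgroup (G ⧸ N), (↥V →* A)) : Prop :=
  q.1 = p.1.map (QuotientGroup.mk' N) ∧
    ∀ (u : ↥p.1) (hu : QuotientGroup.mk' N u ∈ q.1), q.2 ⟨_, hu⟩ = p.2 u

theorem exists_defl {A G : Type*} [CommGroup A] [Group G] (N : Subgroup G) [N.Normal]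
    (p : Σ U : Subgroup G, (↥U →* A)) (h : Triv N p) : ∃ q, IsDefl N p q := by
  have hsurj := (QuotientGroup.mk' N).subgroupMap_surjective p.1
  have hk : ((QuotientGroup.mk' N).subgroupMap p.1).ker ≤ p.2.ker := by
    intro u hu
    rw [MonoidHom.mem_ker] at hu ⊢
    apply h
    have := congrArg Subtype.val hu
    exact (QuotientGroup.eq_one_iff _).1 this
  refine ⟨⟨p.1.map (QuotientGroup.mk' N),
    MonoidHom.liftOfSurjective _ hsurj ⟨p.2, hk⟩⟩, rfl, ?_⟩
  intro u hu
  exact MonoidHom.liftOfRightInverse_comp_apply ((QuotientGroup.mk' N).subgroupMap p.1) _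
    (Function.rightInverse_surjInv hsurj) ⟨p.2, hk⟩ u

theorem IsDefl.triv {A G : Type*} [CommGroup A] [Group G] {N : Subgroup G} [N.Normal]
    {p : Σ U : Subgroup G, (↥U →* A)} {q : Σ V : Subgroup (G ⧸ N), (↥V →* A)}
    (h : IsDefl N p q) : Triv N p := by
  intro u hu
  have h1 : QuotientGroup.mk' N u = 1 := (QuotientGroup.eq_one_iff _).2 hu
  have h2 : QuotientGroup.mk' N u ∈ q.1 := h1 ▸ one_mem _
  rw [← h.2 u h2]
  have : (⟨_, h2⟩ : q.1) = 1 := Subtype.ext h1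
  rw [this, map_one]

theorem IsDefl.unique {A G : Type*} [CommGroup A] [Group G] {N : Subgroup G} [N.Normal]
    {p : Σ U : Subgroup G, (↥U →* A)} {q q' : Σ V : Subgroup (G ⧸ N), (↥V →* A)}
    (h : IsDefl N p q) (h' : IsDefl N p q') : q = q' := by
  apply sigma_ext
  · rw [h.1, h'.1]
  · intro x hx hx'
    have hx2 := hx
    rw [h.1] at hx2
    obtain ⟨u, hu, rfl⟩ := hx2
    rw [h.2 ⟨u, hu⟩ hx, h'.2 ⟨u, hu⟩ hx']

theorem IsDefl.conj {A G : Type*} [CommGroup A] [Group G] {N : Subgroup G} [N.Normal]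
    {p : Σ U : Subgroup G, (↥U →* A)} {q : Σ V : Subgroup (G ⧸ N), (↥V →* A)}
    (h : IsDefl N p q) (g : G) :
    IsDefl N (pairConj g p) (pairConj (QuotientGroup.mk' N g) q) := by
  constructor
  · ext x
    obtain ⟨x, rfl⟩ := QuotientGroup.mk'_surjective N x
    rw [mem_pairConj, h.1]
    simp only [Subgroup.mem_map, mem_pairConj]
    constructor
    · rintro ⟨y, hy, e⟩
      refine ⟨g * y * g⁻¹, by simpa [mul_assoc] using hy, ?_⟩
      rw [map_mul, map_mul, e, map_inv]
      simp [mul_assoc]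
    · rintro ⟨y, hy, e⟩
      refine ⟨_, hy, ?_⟩
      rw [map_mul, map_mul, e, map_inv]
  · rintro ⟨u, hu⟩ hu'
    have h1 := (mem_pairConj _ _ _).1 hu
    have h2 := (mem_pairConj _ _ _).1 hu'
    rw [pairConj_apply _ _ _ _ h1, pairConj_apply _ _ _ _ h2]
    exact h.2 ⟨_, h1⟩ h2

noncomputable def DD {A G 𝕂 : Type*} [CommGroup A] [Group G] [Field 𝕂] (N : Subgroup G) [N.Normal]
    (V : Subgroup (G ⧸ N)) (Ψ : (↥V →* A) →* 𝕂ˣ) (p : Σ U : Subgroup G, (↥U →* A)) : 𝕂 :=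
  if h : Triv N p then FF V Ψ (Classical.choose (exists_defl N p h)) else 0

theorem DD_eq {A G 𝕂 : Type*} [CommGroup A] [Group G] [Field 𝕂] {N : Subgroup G} [N.Normal]
    (V : Subgroup (G ⧸ N)) (Ψ : (↥V →* A) →* 𝕂ˣ) {p : Σ U : Subgroup G, (↥U →* A)}
    {q : Σ V : Subgroup (G ⧸ N), (↥V →* A)} (h : IsDefl N p q) :
    DD N V Ψ p = FF V Ψ q := by
  unfold DD
  rw [dif_pos h.triv, (Classical.choose_spec (exists_defl N p h.triv)).unique h]

theorem triv_conj {A G : Type*} [CommGroup A] [Group G] (N : Subgroup G) [hN : N.Normal]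
    (p : Σ U : Subgroup G, (↥U →* A)) (g : G) (h : Triv N (pairConj g p)) : Triv N p := by
  rintro ⟨u, hu⟩ huN
  have h1 : g * u * g⁻¹ ∈ (pairConj g p).1 := by
    rw [mem_pairConj]; simpa [mul_assoc] using hu
  have h2 := h ⟨_, h1⟩ (hN.conj_mem u huN g)
  rw [pairConj_apply _ _ _ _ ((mem_pairConj _ _ _).1 h1)] at h2
  rw [← h2]
  congr 2
  simp [mul_assoc]

theorem DD_inf {A G 𝕂 : Type*} [CommGroup A] [Group G] [Field 𝕂] (N : Subgroup G) [N.Normal]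
    (V : Subgroup (G ⧸ N)) (Ψ : (↥V →* A) →* 𝕂ˣ) (φ : ↥(⊤ : Subgroup G) →* A)
    (K : Subgroup G) :
    DD N V Ψ (pr φ K) = DD N V Ψ (pr φ (K ⊓ V.comap (QuotientGroup.mk' N))) := by
  set L := V.comap (QuotientGroup.mk' N) with hL
  have hNL : N ≤ L := by
    intro x hx
    have : QuotientGroup.mk' N x = 1 := (QuotientGroup.eq_one_iff _).2 hx
    rw [hL, Subgroup.mem_comap, this]
    exact one_mem _
  have htriv : Triv N (pr φ K) ↔ Triv N (pr φ (K ⊓ L)) := by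
    constructor
    · rintro h ⟨u, hu⟩ huN
      exact h ⟨u, hu.1⟩ huN
    · rintro h ⟨u, hu⟩ huN
      exact h ⟨u, ⟨hu, hNL huN⟩⟩ huN
  by_cases h : Triv N (pr φ K)
  · obtain ⟨q, hq⟩ := exists_defl N _ h
    obtain ⟨q', hq'⟩ := exists_defl N _ (htriv.1 h)
    rw [DD_eq V Ψ hq, DD_eq V Ψ hq']
    apply FF_congr
    · rw [hq.1, hq'.1]
      constructor
      · intro hV x hx
        obtain ⟨u, hu, rfl⟩ := hV hx
        exact ⟨u, ⟨hu, hx⟩, rfl⟩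
      · intro hV
        exact hV.trans (Subgroup.map_mono inf_le_left)
    · intro x hxV hx hx'
      have hx2 := hx'
      rw [hq'.1] at hx2
      obtain ⟨u, hu, rfl⟩ := hx2
      rw [hq.2 ⟨u, hu.1⟩ hx, hq'.2 ⟨u, hu⟩ hx']
      rfl
  · unfold DD
    rw [dif_neg h, dif_neg (fun h' => h (htriv.2 h'))]

theorem card_eq {G : Type*} [Group G] (N : Subgroup G) [N.Normal] (K : Subgroup G) :
    Nat.card K = Nat.card ↥(K ⊓ N) * Nat.card (K.map (QuotientGroup.mk' N)) := by
  rw [← Subgroup.relIndex_ker, QuotientGroup.ker_mk', ← Subgroup.inf_relIndex_left,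
    Subgroup.relIndex, ← Subgroup.card_mul_index ((K ⊓ N).subgroupOf K)]
  congr 1
  exact Nat.card_congr (Subgroup.subgroupOfEquivOfLe inf_le_left).toEquiv

theorem card_conj_inf {G : Type*} [Group G] (N : Subgroup G) [hN : N.Normal] (K : Subgroup G)
    (g : G) : Nat.card ↥((MulAut.conj g).mapSubgroup K ⊓ N) = Nat.card ↥(K ⊓ N) := by
  have h1 : (MulAut.conj g).mapSubgroup N = N := by
    ext x
    change x ∈ N.map _ ↔ x ∈ N
    rw [Subgroup.mem_map]
    constructor
    · rintro ⟨y, hy, rfl⟩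
      exact hN.conj_mem y hy g
    · intro hx
      refine ⟨g⁻¹ * x * g, ?_, by simp [mul_assoc]⟩
      have := hN.conj_mem x hx g⁻¹
      simpa using this
  conv_lhs => rw [← h1]
  rw [← OrderIso.map_inf]
  exact Nat.card_congr ((MulAut.conj g).subgroupMap (K ⊓ N)).symm.toEquiv

section Main

variable {A G 𝕂 B₁ B₂ : Type*} [CommGroup A] [Group G] [Fintype G]
    [Fintype (Subgroup G)] [Field 𝕂] [CharZero 𝕂]
    [Ring B₁] [Algebra 𝕂 B₁] [Ring B₂] [Algebra 𝕂 B₂]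
    [Fintype (↥(⊤ : Subgroup G) →* A)]

theorem species_def
    (N : Subgroup G) [N.Normal]
    (ℬG : FiberedBurnsideData A G 𝕂 B₁)
    (ℬQ : FiberedBurnsideData A (G ⧸ N) 𝕂 B₂)
    (sQ : ∀ K : Subgroup (G ⧸ N), ((↥K →* A) →* 𝕂ˣ) → (B₂ →ₗ[𝕂] 𝕂))
    [Fintype (G ⧸ N)]
    (hsQ : ∀ K Ψ p, sQ K Ψ (ℬQ.b p) =
      (Nat.card p.1 : 𝕂)⁻¹ * ∑ g : G ⧸ N, FF K Ψ (pairConj g p))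
    (d : B₁ →ₗ[𝕂] B₂)
    (hd0 : ∀ p, ¬ Triv N p → d (ℬG.b p) = 0)
    (hd1 : ∀ p q, IsDefl N p q → d (ℬG.b p) = ℬQ.b q)
    (V : Subgroup (G ⧸ N)) (Ψ : (↥V →* A) →* 𝕂ˣ) (p : Σ U : Subgroup G, (↥U →* A)) :
    sQ V Ψ (d (ℬG.b p)) = (Nat.card (p.1.map (QuotientGroup.mk' N)) : 𝕂)⁻¹ *
      ∑ g : G ⧸ N, DD N V Ψ (pairConj g.out p) := by
  by_cases h : Triv N p
  · obtain ⟨q, hq⟩ := exists_defl N p h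
    rw [hd1 p q hq, hsQ, hq.1]
    congr 1
    refine Finset.sum_congr rfl fun g _ => ?_
    rw [DD_eq V Ψ (hq.conj g.out)]
    congr 2
    exact (QuotientGroup.out_eq' g).symm
  · rw [hd0 p h, map_zero, Finset.sum_eq_zero, mul_zero]
    intro g _
    unfold DD
    rw [dif_neg (fun h' => h (triv_conj N p _ h'))]

theorem proper_zero
    (N : Subgroup G) [N.Normal]
    (ℬG : FiberedBurnsideData A G 𝕂 B₁)
    (ℬQ : FiberedBurnsideData A (G ⧸ N) 𝕂 B₂)
    (sQ : ∀ K : Subgroup (G ⧸ N), ((↥K →* A) →* 𝕂ˣ) → (B₂ →ₗ[𝕂] 𝕂))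
    [Fintype (G ⧸ N)]
    (hsQ : ∀ K Ψ p, sQ K Ψ (ℬQ.b p) =
      (Nat.card p.1 : 𝕂)⁻¹ * ∑ g : G ⧸ N, FF K Ψ (pairConj g p))
    (d : B₁ →ₗ[𝕂] B₂)
    (hd0 : ∀ p, ¬ Triv N p → d (ℬG.b p) = 0)
    (hd1 : ∀ p q, IsDefl N p q → d (ℬG.b p) = ℬQ.b q)
    (ν : Subgroup G → ℤ)
    (hν : ∀ M, (∑ K : Subgroup G, if M ≤ K then ν K else 0) = if M = ⊤ then 1 else 0)
    (Φ : (↥(⊤ : Subgroup G) →* A) →* 𝕂ˣ)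
    (V : Subgroup (G ⧸ N)) (hV : V ≠ ⊤) (Ψ : (↥V →* A) →* 𝕂ˣ) :
    sQ V Ψ (d (expl ℬG ν Φ)) = 0 := by
  have hL : V.comap (QuotientGroup.mk' N) ≠ ⊤ := by
    intro h
    apply hV
    rw [eq_top_iff]
    intro x _
    obtain ⟨x, rfl⟩ := QuotientGroup.mk'_surjective N x
    have : x ∈ V.comap (QuotientGroup.mk' N) := h ▸ trivial
    exact this
  have key : ∀ (φ : ↥(⊤ : Subgroup G) →* A) (g : G),
      ∑ K : Subgroup G, (ν K : 𝕂) * ((Nat.card ↥(K ⊓ N) : 𝕂) *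
        DD N V Ψ (pairConj g (pr φ K))) = 0 := by
    intro φ g
    let e := (MulAut.conj g).mapSubgroup
    have h := weisner (𝕂 := 𝕂) (fun K => ν (e.symm K)) (by
      intro M
      rw [← moebius_iso ν hν e M, ← Equiv.sum_comp e.toEquiv]
      refine Finset.sum_congr rfl fun K _ => ?_
      simp) _ hL
      (fun K => (Nat.card ↥(K ⊓ N) : 𝕂) * DD N V Ψ (pr φ K)) (by
        intro K
        have hN : N ≤ V.comap (QuotientGroup.mk' N) := by
          intro x hx
          have : QuotientGroup.mk' N x = 1 := (QuotientGroup.eq_one_iff _).2 hx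
          rw [Subgroup.mem_comap, this]
          exact one_mem _
        have h2 : K ⊓ V.comap (QuotientGroup.mk' N) ⊓ N = K ⊓ N := by
          rw [inf_assoc, inf_eq_right.2 hN]
        rw [DD_inf, h2])
    rw [← h, ← Equiv.sum_comp e.toEquiv (fun K => (ν (e.symm K) : 𝕂) *
      ((Nat.card ↥(K ⊓ N) : 𝕂) * DD N V Ψ (pr φ K)))]
    refine Finset.sum_congr rfl fun K _ => ?_
    change _ = (ν (e.symm (e K)) : 𝕂) * ((Nat.card ↥(e K ⊓ N) : 𝕂) * DD N V Ψ (pr φ (e K)))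
    rw [e.symm_apply_apply, card_conj_inf, pairConj_pr]
  unfold expl
  simp only [map_smul, map_sum, smul_eq_mul]
  rw [Finset.sum_eq_zero, mul_zero]
  intro φ _
  have h2 : ∀ K : Subgroup G, ((Nat.card K : 𝕂) * (ν K : 𝕂) * ((Φ φ⁻¹ : 𝕂ˣ) : 𝕂)) *
      sQ V Ψ (d (ℬG.b (pr φ K))) = ∑ g : G ⧸ N, ((Φ φ⁻¹ : 𝕂ˣ) : 𝕂) * ((ν K : 𝕂) *
        ((Nat.card ↥(K ⊓ N) : 𝕂) * DD N V Ψ (pairConj g.out (pr φ K)))) := by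
    intro K
    rw [species_def N ℬG ℬQ sQ hsQ d hd0 hd1]
    change _ * ((Nat.card (K.map (QuotientGroup.mk' N)) : 𝕂)⁻¹ * _) = _
    have hK : (Nat.card (K.map (QuotientGroup.mk' N)) : 𝕂) ≠ 0 := by
      exact_mod_cast Nat.card_pos.ne'
    rw [card_eq N K, Nat.cast_mul, Finset.mul_sum, Finset.mul_sum]
    refine Finset.sum_congr rfl fun g _ => ?_
    field_simp
  rw [Finset.sum_congr rfl fun K _ => h2 K, Finset.sum_comm]
  apply Finset.sum_eq_zero
  intro g _
  rw [← Finset.mul_sum, key, mul_zero]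

def perp (A : Type*) {G : Type*} [CommGroup A] [Group G] (K : Subgroup G) :
    Subgroup (↥(⊤ : Subgroup G) →* A) where
  carrier := {ψ | ∀ x : ↥(⊤ : Subgroup G), (x : G) ∈ K → ψ x = 1}
  one_mem' := fun _ _ => rfl
  mul_mem' := fun {a b} ha hb x hx => by
    rw [MonoidHom.mul_apply, ha x hx, hb x hx, one_mul]
  inv_mem' := fun {a} ha x hx => by
    rw [MonoidHom.inv_apply, ha x hx, inv_one]

theorem map_top_iff (N : Subgroup G) [N.Normal] (K : Subgroup G) :
    K.map (QuotientGroup.mk' N) = ⊤ ↔ K ⊔ N = ⊤ := by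
  have h := Subgroup.comap_map_eq (QuotientGroup.mk' N) K
  rw [QuotientGroup.ker_mk'] at h
  rw [← h]
  constructor
  · intro h'; rw [h', Subgroup.comap_top]
  · intro h'
    rw [eq_top_iff]
    intro x _
    obtain ⟨x, rfl⟩ := QuotientGroup.mk'_surjective N x
    have : x ∈ (K.map (QuotientGroup.mk' N)).comap (QuotientGroup.mk' N) := h' ▸ trivial
    exact this

theorem defl_pull (N : Subgroup G) [N.Normal] (K : Subgroup G)
    (hK : K.map (QuotientGroup.mk' N) = ⊤)
    (χ : ↥(⊤ : Subgroup (G ⧸ N)) →* A) (ψ : perp A K) :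
    IsDefl N (pr (charPull A (QuotientGroup.mk' N) χ * ψ.1) K) ⟨⊤, χ⟩ := by
  refine ⟨hK.symm, ?_⟩
  rintro ⟨u, hu⟩ hu'
  rw [pr_apply, MonoidHom.mul_apply, ψ.2 ⟨u, trivial⟩ hu, mul_one]
  rfl

theorem top_sum (N : Subgroup G) [N.Normal] (K : Subgroup G)
    [Fintype (↥(⊤ : Subgroup (G ⧸ N)) →* A)]
    (Φ : (↥(⊤ : Subgroup G) →* A) →* 𝕂ˣ)
    (Ψ : (↥(⊤ : Subgroup (G ⧸ N)) →* A) →* 𝕂ˣ) :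
    ∑ φ : ↥(⊤ : Subgroup G) →* A, ((Φ φ⁻¹ : 𝕂ˣ) : 𝕂) * DD N ⊤ Ψ (pr φ K) =
      (if Φ.comp (charPull A (QuotientGroup.mk' N)) = Ψ then
        (Nat.card (↥(⊤ : Subgroup (G ⧸ N)) →* A) : 𝕂) else 0) *
      (if (K ⊔ N = ⊤) ∧ (∀ ψ : ↥(⊤ : Subgroup G) →* A,
                (∀ x : ↥(⊤ : Subgroup G), (x : G) ∈ K → ψ x = 1) → Φ ψ = 1) then
              (Nat.card {ψ : ↥(⊤ : Subgroup G) →* A //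
                ∀ x : ↥(⊤ : Subgroup G), (x : G) ∈ K → ψ x = 1} : 𝕂) else 0) := by
  by_cases hKN : K ⊔ N = ⊤
  · have hK := (map_top_iff N K).2 hKN
    letI : Fintype (perp A K) := Fintype.ofFinite _
    rw [← sum_char]
    have h1 : ∑ ψ : perp A K, ((Φ (ψ.1⁻¹) : 𝕂ˣ) : 𝕂) =
      (if (K ⊔ N = ⊤) ∧ (∀ ψ : ↥(⊤ : Subgroup G) →* A,
                (∀ x : ↥(⊤ : Subgroup G), (x : G) ∈ K → ψ x = 1) → Φ ψ = 1) then
              (Nat.card {ψ : ↥(⊤ : Subgroup G) →* A //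
                ∀ x : ↥(⊤ : Subgroup G), (x : G) ∈ K → ψ x = 1} : 𝕂) else 0) := by
      have h := sum_char (𝕂 := 𝕂) (Φ.comp (perp A K).subtype) 1
      simp only [MonoidHom.one_apply, Units.val_one, mul_one] at h
      refine Eq.trans h ?_
      have hiff : Φ.comp (perp A K).subtype = 1 ↔ (K ⊔ N = ⊤) ∧
          (∀ ψ : ↥(⊤ : Subgroup G) →* A,
                (∀ x : ↥(⊤ : Subgroup G), (x : G) ∈ K → ψ x = 1) → Φ ψ = 1) := by
        constructor
        · intro h
          exact ⟨hKN, fun ψ hψ => DFunLike.congr_fun h (⟨ψ, hψ⟩ : perp A K)⟩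
        · rintro ⟨_, h⟩
          ext ψ
          have := h ψ.1 ψ.2
          simp [this]
      simp only [hiff]
      rfl
    rw [← h1, Finset.sum_mul_sum, ← Fintype.sum_prod_type']
    symm
    refine Fintype.sum_of_injective
      (fun x : (↥(⊤ : Subgroup (G ⧸ N)) →* A) × perp A K =>
        charPull A (QuotientGroup.mk' N) x.1 * x.2.1) ?_ _ _ ?_ ?_
    · rintro ⟨χ, ψ⟩ ⟨χ', ψ'⟩ h
      dsimp only at h
      have h1 := defl_pull N K hK χ ψ
      rw [h] at h1
      have h2 := h1.unique (defl_pull N K hK χ' ψ')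
      have h3 : χ = χ' := by simpa using h2
      subst h3
      have h4 : ψ = ψ' := Subtype.ext (mul_left_cancel h)
      rw [h4]
    · intro φ hφ
      by_cases ht : Triv N (pr φ K)
      · exfalso
        apply hφ
        obtain ⟨⟨U, χ⟩, hq⟩ := exists_defl N _ ht
        have hU : U = ⊤ := hq.1.trans hK
        subst hU
        refine ⟨⟨χ, ⟨(charPull A (QuotientGroup.mk' N) χ)⁻¹ * φ, ?_⟩⟩, by simp⟩
        intro x hx
        rw [MonoidHom.mul_apply, MonoidHom.inv_apply, inv_mul_eq_one]
        exact hq.2 ⟨x.1, hx⟩ trivial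
      · unfold DD
        rw [dif_neg ht, mul_zero]
    · rintro ⟨χ, ψ⟩
      dsimp only
      rw [DD_eq _ _ (defl_pull N K hK χ ψ), mul_inv, map_mul, Units.val_mul]
      have : FF ⊤ Ψ (⟨⊤, χ⟩ : Σ V : Subgroup (G ⧸ N), (↥V →* A)) = ((Ψ χ : 𝕂ˣ) : 𝕂) := by
        unfold FF
        rw [dif_pos le_rfl]
        rfl
      rw [this, MonoidHom.comp_apply, map_inv (charPull A (QuotientGroup.mk' N))]
      ring
  · rw [if_neg (c := K ⊔ N = ⊤ ∧ _) (fun h => hKN h.1), mul_zero]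
    apply Finset.sum_eq_zero
    intro φ _
    by_cases ht : Triv N (pr φ K)
    · obtain ⟨q, hq⟩ := exists_defl N _ ht
      rw [DD_eq _ _ hq]
      unfold FF
      rw [dif_neg, mul_zero]
      intro h
      rw [hq.1, top_le_iff] at h
      exact hKN ((map_top_iff N K).1 h)
    · unfold DD
      rw [dif_neg ht, mul_zero]

theorem top_species
    (N : Subgroup G) [N.Normal]
    (ℬG : FiberedBurnsideData A G 𝕂 B₁)
    (ℬQ : FiberedBurnsideData A (G ⧸ N) 𝕂 B₂)
    (sQ : ∀ K : Subgroup (G ⧸ N), ((↥K →* A) →* 𝕂ˣ) → (B₂ →ₗ[𝕂] 𝕂))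
    [Fintype (↥(⊤ : Subgroup (G ⧸ N)) →* A)]
    (hsQ : ∀ Ψ p, sQ ⊤ Ψ (ℬQ.b p) = FF ⊤ Ψ p)
    (d : B₁ →ₗ[𝕂] B₂)
    (hd0 : ∀ p, ¬ Triv N p → d (ℬG.b p) = 0)
    (hd1 : ∀ p q, IsDefl N p q → d (ℬG.b p) = ℬQ.b q)
    (ν : Subgroup G → ℤ)
    (Φ : (↥(⊤ : Subgroup G) →* A) →* 𝕂ˣ)
    (Ψ : (↥(⊤ : Subgroup (G ⧸ N)) →* A) →* 𝕂ˣ) :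
    sQ ⊤ Ψ (d (expl ℬG ν Φ)) = ((Nat.card (↥(⊤ : Subgroup (G ⧸ N)) →* A) : 𝕂) *
        ((Nat.card G : 𝕂) * (Nat.card (↥(⊤ : Subgroup G) →* A) : 𝕂))⁻¹ *
        ∑ K : Subgroup G,
          if (K ⊔ N = ⊤) ∧
              (∀ ψ : ↥(⊤ : Subgroup G) →* A,
                (∀ x : ↥(⊤ : Subgroup G), (x : G) ∈ K → ψ x = 1) → Φ ψ = 1) then
            (Nat.card ↥K : 𝕂) *
              (Nat.card {ψ : ↥(⊤ : Subgroup G) →* A //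
                ∀ x : ↥(⊤ : Subgroup G), (x : G) ∈ K → ψ x = 1} : 𝕂) * (ν K : 𝕂)
          else 0) * (if Φ.comp (charPull A (QuotientGroup.mk' N)) = Ψ then 1 else 0) := by
  have h0 : ∀ p, sQ ⊤ Ψ (d (ℬG.b p)) = DD N ⊤ Ψ p := by
    intro p
    by_cases h : Triv N p
    · obtain ⟨q, hq⟩ := exists_defl N p h
      rw [hd1 p q hq, hsQ, DD_eq _ _ hq]
    · unfold DD
      rw [hd0 p h, map_zero, dif_neg h]
  unfold expl
  simp only [map_smul, map_sum, smul_eq_mul, h0]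
  rw [Finset.sum_comm]
  have h2 : ∀ K : Subgroup G, ∑ φ : ↥(⊤ : Subgroup G) →* A,
      ((Nat.card K : 𝕂) * (ν K : 𝕂) * ((Φ φ⁻¹ : 𝕂ˣ) : 𝕂)) * DD N ⊤ Ψ (pr φ K) =
      ((Nat.card K : 𝕂) * (ν K : 𝕂)) *
        ∑ φ : ↥(⊤ : Subgroup G) →* A, ((Φ φ⁻¹ : 𝕂ˣ) : 𝕂) * DD N ⊤ Ψ (pr φ K) := by
    intro K
    rw [Finset.mul_sum]
    exact Finset.sum_congr rfl fun φ _ => by ring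
  rw [Finset.sum_congr rfl fun K _ => h2 K]
  simp only [top_sum]
  by_cases hΨ : Φ.comp (charPull A (QuotientGroup.mk' N)) = Ψ
  · simp only [if_pos hΨ, mul_one, Finset.mul_sum]
    refine Finset.sum_congr rfl fun K _ => ?_
    split_ifs
    · ring
    · simp
  · simp [if_neg hΨ]

end Main

end Stmt15

theorem stmt_15 {A G 𝕂 B₁ B₂ : Type*} [CommGroup A] [Group G] [Fintype G]
    [Fintype (Subgroup G)] [Field 𝕂] [CharZero 𝕂]
    [Ring B₁] [Algebra 𝕂 B₁] [Ring B₂] [Algebra 𝕂 B₂]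
    (hfinG : ∀ K : Subgroup G, Finite (↥K →* A))
    (hsplitG : ∀ K : Subgroup G, ∃ ζ : 𝕂, IsPrimitiveRoot ζ (Monoid.exponent (↥K →* A)))
    (N : Subgroup G) [N.Normal]
    -- the fibered Burnside algebras of G and of G/N
    (ℬG : FiberedBurnsideData A G 𝕂 B₁)
    (ℬQ : FiberedBurnsideData A (G ⧸ N) 𝕂 B₂)
    -- the species homomorphisms of both algebras
    (sG : ∀ K : Subgroup G, ((↥K →* A) →* 𝕂ˣ) → (B₁ →ₗ[𝕂] 𝕂))
    (hsG : ∀ (K : Subgroup G) (Ψ : (↥K →* A) →* 𝕂ˣ) (p : Σ U : Subgroup G, (↥U →* A))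
      (R : Finset G), IsDCR K p.1 R →
      sG K Ψ (ℬG.b p) = ∑ r ∈ R,
        (if h : K ≤ (pairConj r p).1 then
          ((Ψ ((pairConj r p).2.comp (Subgroup.inclusion h)) : 𝕂ˣ) : 𝕂) else 0))
    (sQ : ∀ K : Subgroup (G ⧸ N), ((↥K →* A) →* 𝕂ˣ) → (B₂ →ₗ[𝕂] 𝕂))
    (hsQ : ∀ (K : Subgroup (G ⧸ N)) (Ψ : (↥K →* A) →* 𝕂ˣ)
      (p : Σ U : Subgroup (G ⧸ N), (↥U →* A)) (R : Finset (G ⧸ N)), IsDCR K p.1 R →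
      sQ K Ψ (ℬQ.b p) = ∑ r ∈ R,
        (if h : K ≤ (pairConj r p).1 then
          ((Ψ ((pairConj r p).2.comp (Subgroup.inclusion h)) : 𝕂ˣ) : 𝕂) else 0))
    -- the deflation map def^G_{G/N}
    (d : B₁ →ₗ[𝕂] B₂)
    (hd0 : ∀ p : Σ U : Subgroup G, (↥U →* A),
      (¬ ∀ u : ↥p.1, (u : G) ∈ N → p.2 u = 1) → d (ℬG.b p) = 0)
    (hd1 : ∀ p : Σ U : Subgroup G, (↥U →* A),
      (∀ u : ↥p.1, (u : G) ∈ N → p.2 u = 1) →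
      ∀ q : Σ V : Subgroup (G ⧸ N), (↥V →* A),
        q.1 = p.1.map (QuotientGroup.mk' N) →
        (∀ (u : ↥p.1) (hu : QuotientGroup.mk' N u ∈ q.1), q.2 ⟨_, hu⟩ = p.2 u) →
        d (ℬG.b p) = ℬQ.b q)
    -- the Möbius function of the subgroup lattice of G
    (μ : Subgroup G → Subgroup G → ℤ)
    (hμ : ∀ K L : Subgroup G, K ≤ L →
      (∑ M : Subgroup G, if K ≤ M ∧ M ≤ L then μ M L else 0) = if K = L then 1 else 0)
    -- Φ ∈ Hom(G*,𝕂ˣ) and the primitive idempotents e^G_{(G,Φ)} and e^{G/N}_{(G/N,Φ_N)}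
    (Φ : (↥(⊤ : Subgroup G) →* A) →* 𝕂ˣ)
    (eG : B₁)
    (heG : ∀ (K : Subgroup G) (Ψ : (↥K →* A) →* 𝕂ˣ),
      sG K Ψ eG = if ∃ g : G, charPairConj g
        (⟨⊤, Φ⟩ : Σ K : Subgroup G, ((↥K →* A) →* 𝕂ˣ)) = ⟨K, Ψ⟩ then 1 else 0)
    (eQ : B₂)
    (heQ : ∀ (K : Subgroup (G ⧸ N)) (Ψ : (↥K →* A) →* 𝕂ˣ),
      sQ K Ψ eQ = if ∃ g : G ⧸ N, charPairConj g
        (⟨⊤, Φ.comp (charPull A (QuotientGroup.mk' N))⟩ :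
          Σ K : Subgroup (G ⧸ N), ((↥K →* A) →* 𝕂ˣ)) = ⟨K, Ψ⟩ then 1 else 0) :
    d eG =
      ((Nat.card (↥(⊤ : Subgroup (G ⧸ N)) →* A) : 𝕂) *
        ((Nat.card G : 𝕂) * (Nat.card (↥(⊤ : Subgroup G) →* A) : 𝕂))⁻¹ *
        ∑ K : Subgroup G,
          if (K ⊔ N = ⊤) ∧
              (∀ ψ : ↥(⊤ : Subgroup G) →* A,
                (∀ x : ↥(⊤ : Subgroup G), (x : G) ∈ K → ψ x = 1) → Φ ψ = 1) then
            (Nat.card ↥K : 𝕂) *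
              (Nat.card {ψ : ↥(⊤ : Subgroup G) →* A //
                ∀ x : ↥(⊤ : Subgroup G), (x : G) ∈ K → ψ x = 1} : 𝕂) * (μ K ⊤ : 𝕂)
          else 0) • eQ ∧
    ∀ m : 𝕂, d eG = m • eQ → ∃ q : ℚ, m = (q : 𝕂) := by
  letI : Fintype (↥(⊤ : Subgroup G) →* A) := @Fintype.ofFinite _ (hfinG ⊤)
  letI : Fintype (G ⧸ N) := Fintype.ofFinite _
  -- characters of subgroups of the quotient
  have hpull : ∀ V : Subgroup (G ⧸ N), ∃ e : (↥V →* A) →*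
      (↥(V.comap (QuotientGroup.mk' N)) →* A), Function.Injective e := by
    intro V
    refine ⟨⟨⟨fun χ => χ.comp ((QuotientGroup.mk' N).subgroupComap V),
      MonoidHom.one_comp _⟩, fun _ _ => MonoidHom.mul_comp _ _ _⟩, ?_⟩
    intro χ χ' h
    have hsurj := (QuotientGroup.mk' N).subgroupComap_surjective_of_surjective V
      (QuotientGroup.mk'_surjective N)
    exact (MonoidHom.cancel_right hsurj).1 h
  have hfinQ : ∀ V : Subgroup (G ⧸ N), Finite (↥V →* A) := by
    intro V
    obtain ⟨e, he⟩ := hpull V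
    haveI := hfinG (V.comap (QuotientGroup.mk' N))
    exact Finite.of_injective e he
  have hsplitQ : ∀ V : Subgroup (G ⧸ N),
      ∃ ζ : 𝕂, IsPrimitiveRoot ζ (Monoid.exponent (↥V →* A)) := by
    intro V
    obtain ⟨e, he⟩ := hpull V
    haveI := hfinG (V.comap (QuotientGroup.mk' N))
    obtain ⟨ζ, hζ⟩ := hsplitG (V.comap (QuotientGroup.mk' N))
    obtain ⟨k, hk⟩ := Monoid.exponent_dvd_of_monoidHom e he
    exact ⟨ζ ^ k, hζ.pow (Nat.pos_of_ne_zero Monoid.exponent_ne_zero_of_finite)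
      (by rw [hk, mul_comm])⟩
  letI : Fintype (↥(⊤ : Subgroup (G ⧸ N)) →* A) := @Fintype.ofFinite _ (hfinQ ⊤)
  -- averaged species formulas
  have hsG' : ∀ (K : Subgroup G) (Ψ : (↥K →* A) →* 𝕂ˣ) p, sG K Ψ (ℬG.b p) =
      (Nat.card p.1 : 𝕂)⁻¹ * ∑ g : G, Stmt15.FF K Ψ (pairConj g p) := by
    intro K Ψ p
    obtain ⟨R, hR, h⟩ := Stmt15.species_sum K Ψ p
    rw [hsG K Ψ p R hR, ← h]
    rfl
  have hsQ' : ∀ (K : Subgroup (G ⧸ N)) (Ψ : (↥K →* A) →* 𝕂ˣ) p, sQ K Ψ (ℬQ.b p) =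
      (Nat.card p.1 : 𝕂)⁻¹ * ∑ g : G ⧸ N, Stmt15.FF K Ψ (pairConj g p) := by
    intro K Ψ p
    obtain ⟨R, hR, h⟩ := Stmt15.species_sum K Ψ p
    rw [hsQ K Ψ p R hR, ← h]
    rfl
  have hsQtop : ∀ (Ψ : (↥(⊤ : Subgroup (G ⧸ N)) →* A) →* 𝕂ˣ) p,
      sQ ⊤ Ψ (ℬQ.b p) = Stmt15.FF ⊤ Ψ p := by
    intro Ψ p
    rw [hsQ ⊤ Ψ p {1} ⟨fun x => ⟨1, by simp, x, trivial, 1, one_mem _, by simp⟩,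
      by simp⟩, Finset.sum_singleton]
    change Stmt15.FF ⊤ Ψ (pairConj 1 p) = _
    rw [Stmt15.pairConj_mem p 1 (one_mem _)]
  have hν : ∀ M : Subgroup G, (∑ K : Subgroup G, if M ≤ K then μ K ⊤ else 0) =
      if M = ⊤ then 1 else 0 := by
    intro M
    have := hμ M ⊤ le_top
    simpa using this
  have hd1' : ∀ p q, Stmt15.IsDefl N p q → d (ℬG.b p) = ℬQ.b q :=
    fun p q h => hd1 p h.triv q h.1 h.2
  -- the explicit formula for the idempotent
  have heG' : eG = Stmt15.expl ℬG (fun K => μ K ⊤) Φ := by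
    rw [← sub_eq_zero]
    apply Stmt15.species_inj hfinG hsplitG ℬG sG hsG'
    intro K Ψ
    rw [map_sub, heG, Stmt15.expl_species ℬG sG hsG' _ hν, sub_self]
  have hmain : d eG =
      ((Nat.card (↥(⊤ : Subgroup (G ⧸ N)) →* A) : 𝕂) *
        ((Nat.card G : 𝕂) * (Nat.card (↥(⊤ : Subgroup G) →* A) : 𝕂))⁻¹ *
        ∑ K : Subgroup G,
          if (K ⊔ N = ⊤) ∧
              (∀ ψ : ↥(⊤ : Subgroup G) →* A,
                (∀ x : ↥(⊤ : Subgroup G), (x : G) ∈ K → ψ x = 1) → Φ ψ = 1) then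
            (Nat.card ↥K : 𝕂) *
              (Nat.card {ψ : ↥(⊤ : Subgroup G) →* A //
                ∀ x : ↥(⊤ : Subgroup G), (x : G) ∈ K → ψ x = 1} : 𝕂) * (μ K ⊤ : 𝕂)
          else 0) • eQ := by
    rw [← sub_eq_zero]
    apply Stmt15.species_inj hfinQ hsplitQ ℬQ sQ hsQ'
    intro V Ψ
    rw [map_sub, map_smul, heQ, heG', smul_eq_mul]
    by_cases hV : V = ⊤
    · subst hV
      rw [Stmt15.top_species N ℬG ℬQ sQ hsQtop d hd0 hd1']
      simp only [Stmt15.charPairConj_iff]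
      exact sub_self _
    · rw [Stmt15.proper_zero N ℬG ℬQ sQ hsQ' d hd0 hd1' _ hν Φ V hV,
        if_neg (Stmt15.charPairConj_ne _ V hV Ψ)]
      simp
  refine ⟨by convert hmain, ?_⟩
  intro m hm
  have he : sQ ⊤ (Φ.comp (charPull A (QuotientGroup.mk' N))) eQ = 1 := by
    rw [heQ, if_pos]
    exact (Stmt15.charPairConj_iff _ _).2 rfl
  rw [hmain] at hm
  have h2 := congrArg (sQ ⊤ (Φ.comp (charPull A (QuotientGroup.mk' N)))) hm
  rw [map_smul, map_smul, he, smul_eq_mul, smul_eq_mul, mul_one, mul_one] at h2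
  refine ⟨(Nat.card (↥(⊤ : Subgroup (G ⧸ N)) →* A) : ℚ) *
        ((Nat.card G : ℚ) * (Nat.card (↥(⊤ : Subgroup G) →* A) : ℚ))⁻¹ *
        ∑ K : Subgroup G,
          if (K ⊔ N = ⊤) ∧
              (∀ ψ : ↥(⊤ : Subgroup G) →* A,
                (∀ x : ↥(⊤ : Subgroup G), (x : G) ∈ K → ψ x = 1) → Φ ψ = 1) then
            (Nat.card ↥K : ℚ) *
              (Nat.card {ψ : ↥(⊤ : Subgroup G) →* A //
                ∀ x : ↥(⊤ : Subgroup G), (x : G) ∈ K → ψ x = 1} : ℚ) * (μ K ⊤ : ℚ)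
          else 0, ?_⟩
  rw [← h2, Rat.cast_mul, Rat.cast_sum]
  congr 1
  · simp only [Rat.cast_mul, Rat.cast_inv, Rat.cast_natCast]
  · refine Finset.sum_congr rfl fun K _ => ?_
    split_ifs
    · simp only [Rat.cast_mul, Rat.cast_natCast, Rat.cast_intCast]
    · exact Rat.cast_zero.symm
end
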